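/- arXiv:1609.02250 — 2 statements merged into one kernel-verified Lean document; each statement's English description precedes it below -/
import Mathlib

section
/- The F_2-vector space (QP_5)_9 has dimension 191, i.e., the space of homogeneous polynomials of degree 9 in P_5 modulo hit polynomials has dimension 191 over F_2. -/
open MvPolynomial

noncomputable section

/-- The polynomial algebra `P_5 = F_2[x_1,...,x_5]`. -/
abbrev P5 : Type := MvPolynomial (Fin 5) (ZMod 2)

/-- The total Steenrod square: the `F_2`-algebra endomorphism with `Sq (x_i) = x_i + x_i ^ 2`. -/
def Sq : P5 →ₐ[ZMod 2] P5 := aeval fun i => X i + X i ^ 2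

/-- `f` (homogeneous of degree `n`) is hit if it is the degree-`n` homogeneous component of
`Sq g` for some `g` all of whose homogeneous components have degree `< n`. -/
def IsHit (n : ℕ) (f : P5) : Prop :=
  ∃ g : P5, (∀ m, n ≤ m → homogeneousComponent m g = 0) ∧
    f = homogeneousComponent n (Sq g)

/-- The subspace of hit polynomials of degree `n`. -/
def hitSpan (n : ℕ) : Submodule (ZMod 2) P5 :=
  Submodule.span (ZMod 2) {f : P5 | IsHit n f}

/-- The action of `GL_5(F_2)` on `P_5` by linear substitution of the variables. -/
def actGL (g : Matrix.GeneralLinearGroup (Fin 5) (ZMod 2)) : P5 →ₐ[ZMod 2] P5 :=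
  aeval fun i => ∑ j, ((g : Matrix (Fin 5) (Fin 5) (ZMod 2)) i j) • X j

/-- `wt d i` is the `(i+1)`-st entry `ω_{i+1}` of the weight vector of the monomial with
exponent vector `d`, i.e. the number of `j` such that bit `i` of `d j` is `1`. -/
def wt (d : Fin 5 →₀ ℕ) (i : ℕ) : ℕ :=
  (Finset.univ.filter fun j : Fin 5 => Nat.testBit (d j) i).card

/-- The weight vector of the exponent vector `d` equals the (finitely supported) list `w`. -/
def hasWt (d : Fin 5 →₀ ℕ) (w : List ℕ) : Prop :=
  ∀ i, wt d i = w.getD i 0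

/-- The weight vector of `d` is strictly smaller than `w` in left lexicographic order. -/
def wtLt (d : Fin 5 →₀ ℕ) (w : List ℕ) : Prop :=
  ∃ i, (∀ j, j < i → wt d j = w.getD j 0) ∧ wt d i < w.getD i 0

/-- `P_5^-(ω)`: the span of degree-`n` monomials whose weight vector is `< w`. -/
def PMinus (n : ℕ) (w : List ℕ) : Submodule (ZMod 2) P5 :=
  Submodule.span (ZMod 2)
    {x : P5 | ∃ d : Fin 5 →₀ ℕ, x = monomial d 1 ∧ (∑ j, d j) = n ∧ wtLt d w}

/-- `P_5(ω)`: the span of degree-`n` monomials whose weight vector is `≤ w`. -/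
def PLe (n : ℕ) (w : List ℕ) : Submodule (ZMod 2) P5 :=
  Submodule.span (ZMod 2)
    {x : P5 | ∃ d : Fin 5 →₀ ℕ, x = monomial d 1 ∧ (∑ j, d j) = n ∧ (wtLt d w ∨ hasWt d w)}

/-- The monomial `x_1^a x_2^b x_3^c x_4^d x_5^e`. -/
def mon (a b c d e : ℕ) : P5 :=
  X 0 ^ a * X 1 ^ b * X 2 ^ c * X 3 ^ d * X 4 ^ e

namespace HitProblem

/-! ### Bit vectors and Gaussian elimination

Vectors over `F_2` are stored as natural numbers. The executable definitions use recursors and the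
primitive operations on `ℕ`, so that the kernel evaluates them efficiently. -/

/-- Application of `k` to `n`, evaluating `n` first. -/
def force {α : Type} (n : ℕ) (k : ℕ → α) : α :=
  Nat.rec (k 0) (fun m _ => k m.succ) n

/-- Clears the leading bit of `b` in `v` by adding `b` if necessary. -/
def reduceBit (b v : ℕ) : ℕ :=
  force (Nat.xor v b) fun u => Bool.rec v u (Nat.ble u v)

/-- Reduces `v` by the members of `B`, the last one first. -/
def reduce (B : List ℕ) (v : ℕ) : ℕ :=
  List.rec v (fun b _ w => force w (reduceBit b)) B

/-- The number of pivots after extending the echelon basis `B` by the vectors in `l`. -/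
def elimRank (l : List ℕ) : List ℕ → ℕ :=
  List.rec (fun B => B.length) (fun v _ ih B => force (reduce B v) fun w =>
    Nat.rec (ih B) (fun _ _ => ih (w :: B)) w) l

@[simp]
theorem force_eq {α : Type} (n : ℕ) (k : ℕ → α) : force n k = k n := by
  cases n <;> rfl

theorem reduceBit_eq (b v : ℕ) :
    reduceBit b v = if v ^^^ b ≤ v then v ^^^ b else v := by
  have h : reduceBit b v = Bool.rec v (v ^^^ b) (Nat.ble (v ^^^ b) v) := force_eq _ _
  rw [h]
  split_ifs with hle
  · rw [Nat.ble_eq_true_of_le hle]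
  · rw [Bool.eq_false_iff.mpr (fun h => hle (Nat.le_of_ble_eq_true h))]

theorem reduce_cons (b : ℕ) (B : List ℕ) (v : ℕ) :
    reduce (b :: B) v = reduceBit b (reduce B v) :=
  force_eq _ _

theorem elimRank_cons (v : ℕ) (l B : List ℕ) :
    elimRank (v :: l) B =
      if reduce B v = 0 then elimRank l B else elimRank l (reduce B v :: B) := by
  have h : elimRank (v :: l) B = force (reduce B v) fun w =>
      Nat.rec (motive := fun _ => ℕ) (elimRank l B) (fun _ _ => elimRank l (w :: B)) w :=
    rfl
  rw [h, force_eq]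
  cases reduce B v <;> simp

theorem testBit_eq_false_of_log2_lt {b i : ℕ} (h : b.log2 < i) : b.testBit i = false :=
  Nat.testBit_lt_two_pow ((Nat.lt_log2_self).trans_le (Nat.pow_le_pow_right two_pos h))

theorem testBit_reduceBit_log2 {b : ℕ} (hb : b ≠ 0) (v : ℕ) :
    (reduceBit b v).testBit b.log2 = false := by
  have hlead := Nat.testBit_log2 hb
  have hhigh : ∀ j, b.log2 < j → (v ^^^ b).testBit j = v.testBit j := fun j hj => by
    simp [Nat.testBit_xor, testBit_eq_false_of_log2_lt hj]
  rw [reduceBit_eq]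
  cases hv : v.testBit b.log2 with
  | true =>
    have hu : (v ^^^ b).testBit b.log2 = false := by simp [Nat.testBit_xor, hlead, hv]
    rwa [if_pos (Nat.lt_of_testBit _ hu hv hhigh).le]
  | false =>
    have hu : (v ^^^ b).testBit b.log2 = true := by simp [Nat.testBit_xor, hlead, hv]
    rwa [if_neg (Nat.lt_of_testBit _ hv hu fun j hj => (hhigh j hj).symm).not_ge]

theorem testBit_reduceBit_of_eq_false {b v i : ℕ} (hb : b.testBit i = false)
    (hv : v.testBit i = false) : (reduceBit b v).testBit i = false := by
  rw [reduceBit_eq]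
  split_ifs
  · simp [Nat.testBit_xor, hb, hv]
  · exact hv

/-- Every member of the list is nonzero and vanishes at the leading bits of the later members. -/
def IsEchelon (B : List ℕ) : Prop :=
  (∀ b ∈ B, b ≠ 0) ∧ B.Pairwise fun b c => b.testBit c.log2 = false

theorem isEchelon_cons {b : ℕ} {B : List ℕ} :
    IsEchelon (b :: B) ↔ (b ≠ 0 ∧ ∀ c ∈ B, b.testBit c.log2 = false) ∧ IsEchelon B := by
  simp only [IsEchelon, List.forall_mem_cons, List.pairwise_cons]
  tauto

theorem testBit_reduce_log2 {B : List ℕ} (hB : IsEchelon B) (v : ℕ) :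
    ∀ c ∈ B, (reduce B v).testBit c.log2 = false := by
  induction B with
  | nil => simp
  | cons b B ih =>
    obtain ⟨⟨hb, hbB⟩, hB⟩ := isEchelon_cons.mp hB
    rw [reduce_cons, List.forall_mem_cons]
    exact ⟨testBit_reduceBit_log2 hb _,
      fun c hc => testBit_reduceBit_of_eq_false (hbB c hc) (ih hB c hc)⟩

/-- The power series over `F_2` whose coefficients are the binary digits of `n`. -/
def bits (n : ℕ) : PowerSeries (ZMod 2) :=
  PowerSeries.mk fun i => if n.testBit i then 1 else 0

theorem coeff_bits (n i : ℕ) :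
    PowerSeries.coeff i (bits n) = if n.testBit i then 1 else 0 :=
  PowerSeries.coeff_mk _ _

theorem bits_zero : bits 0 = 0 := by
  ext i
  simp [coeff_bits]

theorem bits_one : bits 1 = 1 := by
  ext i
  simp only [coeff_bits, PowerSeries.coeff_one, Nat.testBit_one_eq_true_iff_self_eq_zero]

theorem bits_xor (a b : ℕ) : bits (a ^^^ b) = bits a + bits b := by
  ext i
  simp only [map_add, coeff_bits, Nat.testBit_xor]
  cases a.testBit i <;> cases b.testBit i <;> decide

theorem bits_shiftLeft (a w : ℕ) : bits (a <<< w) = PowerSeries.X ^ w * bits a := by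
  ext i
  rw [PowerSeries.coeff_X_pow_mul', coeff_bits, coeff_bits, Nat.testBit_shiftLeft]
  by_cases h : w ≤ i <;> simp [h]

/-- The span of the vectors encoded by the members of `l`. -/
def spanBits (l : List ℕ) : Submodule (ZMod 2) (PowerSeries (ZMod 2)) :=
  Submodule.span (ZMod 2) (bits '' {v | v ∈ l})

theorem spanBits_nil : spanBits [] = ⊥ := by
  simp [spanBits]

theorem spanBits_cons (v : ℕ) (l : List ℕ) :
    spanBits (v :: l) = Submodule.span (ZMod 2) {bits v} ⊔ spanBits l := by
  have h : {x | x ∈ v :: l} = insert v {x | x ∈ l} := by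
    ext x
    simp
  rw [spanBits, h, Set.image_insert_eq, Submodule.span_insert, spanBits]

theorem bits_mem_spanBits {v : ℕ} {l : List ℕ} (h : v ∈ l) : bits v ∈ spanBits l :=
  Submodule.subset_span ⟨v, h, rfl⟩

theorem bits_reduce_sub_mem (B : List ℕ) (v : ℕ) : bits (reduce B v) - bits v ∈ spanBits B := by
  induction B with
  | nil => exact (sub_self (bits v)).symm ▸ zero_mem _
  | cons b B ih =>
    have hB : spanBits B ≤ spanBits (b :: B) := spanBits_cons b B ▸ le_sup_right
    rw [reduce_cons, reduceBit_eq]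
    split_ifs
    · rw [bits_xor, add_sub_right_comm]
      exact add_mem (hB ih) (bits_mem_spanBits List.mem_cons_self)
    · exact hB ih

theorem spanBits_reduce_cons (B : List ℕ) (v : ℕ) :
    spanBits (reduce B v :: B) = spanBits (v :: B) := by
  have h := bits_reduce_sub_mem B v
  rw [spanBits_cons, spanBits_cons]
  refine le_antisymm (sup_le ?_ le_sup_right) (sup_le ?_ le_sup_right) <;>
    rw [Submodule.span_singleton_le_iff_mem]
  · rw [← add_sub_cancel (bits v) (bits (reduce B v))]
    exact add_mem (Submodule.mem_sup_left (Submodule.mem_span_singleton_self _))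
      (Submodule.mem_sup_right h)
  · rw [← sub_sub_cancel (bits (reduce B v)) (bits v)]
    exact sub_mem (Submodule.mem_sup_left (Submodule.mem_span_singleton_self _))
      (Submodule.mem_sup_right h)

theorem eq_zero_of_mem_spanBits {B : List ℕ} (hB : IsEchelon B) {x : PowerSeries (ZMod 2)}
    (hx : x ∈ spanBits B) (hlead : ∀ c ∈ B, PowerSeries.coeff c.log2 x = 0) : x = 0 := by
  induction B generalizing x with
  | nil => simpa [spanBits_nil] using hx
  | cons b B ih =>
    obtain ⟨⟨hb, hbB⟩, hB⟩ := isEchelon_cons.mp hB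
    rw [spanBits_cons, Submodule.mem_sup] at hx
    obtain ⟨_, hz, y, hy, rfl⟩ := hx
    obtain ⟨a, rfl⟩ := Submodule.mem_span_singleton.mp hz
    have hy0 : y = 0 := ih hB hy fun c hc => by
      simpa [coeff_bits, hbB c hc] using hlead c (List.mem_cons_of_mem _ hc)
    have ha : a = 0 := by
      simpa [coeff_bits, Nat.testBit_log2 hb, hy0] using hlead b List.mem_cons_self
    simp [ha, hy0]

theorem bits_notMem_spanBits {b : ℕ} {B : List ℕ} (hB : IsEchelon (b :: B)) :
    bits b ∉ spanBits B := fun hmem => by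
  obtain ⟨⟨hb, hbB⟩, hB⟩ := isEchelon_cons.mp hB
  have h0 := eq_zero_of_mem_spanBits hB hmem fun c hc => by simp [coeff_bits, hbB c hc]
  simpa [coeff_bits, Nat.testBit_log2 hb] using congrArg (PowerSeries.coeff b.log2) h0

theorem finrank_spanBits_of_isEchelon {B : List ℕ} (hB : IsEchelon B) :
    Module.finrank (ZMod 2) (spanBits B) = B.length := by
  have hrange (C : List ℕ) : Set.range (fun i : Fin C.length => bits (C.get i)) =
      bits '' {v | v ∈ C} := by
    rw [← Set.range_list_get, ← Set.range_comp]
    rfl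
  have hli : LinearIndependent (ZMod 2) fun i : Fin B.length => bits (B.get i) := by
    induction B with
    | nil =>
      have : IsEmpty (Fin ([] : List ℕ).length) := Fin.isEmpty
      exact linearIndependent_empty_type
    | cons b B ih =>
      have hcons : (fun i : Fin (b :: B).length => bits ((b :: B).get i)) =
          (Fin.cons (bits b) fun i : Fin B.length => bits (B.get i) :
            Fin (B.length + 1) → PowerSeries (ZMod 2)) :=
        funext fun i => Fin.cases rfl (fun _ => rfl) i
      rw [hcons, linearIndependent_finCons, hrange]
      exact ⟨ih (isEchelon_cons.mp hB).2, bits_notMem_spanBits hB⟩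
  rw [spanBits, ← hrange, finrank_span_eq_card hli, Fintype.card_fin]

theorem finrank_spanBits_sup {l B : List ℕ} (hB : IsEchelon B) :
    Module.finrank (ZMod 2) ↥(spanBits l ⊔ spanBits B) = elimRank l B := by
  induction l generalizing B with
  | nil =>
    rw [spanBits_nil, bot_sup_eq]
    exact finrank_spanBits_of_isEchelon hB
  | cons v l ih =>
    have hspan : spanBits (v :: l) ⊔ spanBits B = spanBits l ⊔ spanBits (reduce B v :: B) := by
      rw [spanBits_reduce_cons, spanBits_cons, spanBits_cons, sup_comm (Submodule.span _ _),
        sup_assoc]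
    rw [hspan, elimRank_cons]
    split_ifs with hw
    · rw [hw, spanBits_cons, bits_zero, Submodule.span_singleton_eq_bot.mpr rfl, bot_sup_eq, ih hB]
    · exact ih (isEchelon_cons.mpr ⟨⟨hw, testBit_reduce_log2 hB v⟩, hB⟩)

theorem finrank_spanBits (l : List ℕ) :
    Module.finrank (ZMod 2) (spanBits l) = elimRank l [] := by
  rw [← finrank_spanBits_sup (B := []) (by simp [IsEchelon]), spanBits_nil, sup_bot_eq]

/-! ### Steenrod squares of words in the variables -/

theorem homogeneousComponent_succ_X_mul (n : ℕ) (j : Fin 5) (p : P5) :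
    homogeneousComponent (n + 1) (X j * p) = X j * homogeneousComponent n p := by
  ext d
  rw [coeff_homogeneousComponent, coeff_X_mul', coeff_X_mul', coeff_homogeneousComponent]
  by_cases hj : j ∈ d.support
  · have hle : Finsupp.single j 1 ≤ d := by
      rw [Finsupp.single_le_iff]
      exact Nat.one_le_iff_ne_zero.mpr (Finsupp.mem_support_iff.mp hj)
    have hdeg : d.degree = (d - Finsupp.single j 1).degree + 1 := by
      conv_lhs => rw [← tsub_add_cancel_of_le hle, map_add, Finsupp.degree_single]
    simp [hj, hdeg]
  · simp [hj]

theorem homogeneousComponent_zero_X_mul (j : Fin 5) (p : P5) :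
    homogeneousComponent 0 (X j * p) = 0 := by
  ext d
  rw [coeff_homogeneousComponent, coeff_X_mul', coeff_zero]
  split_ifs with hd hj
  · simp [(Finsupp.degree_eq_zero_iff d).mp hd] at hj
  all_goals rfl

/-- The product of the variables in a word. -/
def wordProd (js : List (Fin 5)) : P5 := (js.map X).prod

theorem Sq_wordProd_cons (j : Fin 5) (js : List (Fin 5)) :
    Sq (wordProd (j :: js)) = X j * Sq (wordProd js) + X j * (X j * Sq (wordProd js)) := by
  simp only [wordProd, List.map_cons, List.prod_cons, map_mul]
  simp only [Sq, aeval_X]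
  ring

theorem homogeneousComponent_Sq_wordProd_of_lt {js : List (Fin 5)} {m : ℕ} (h : m < js.length) :
    homogeneousComponent m (Sq (wordProd js)) = 0 := by
  induction js generalizing m with
  | nil => simp at h
  | cons j js ih =>
    rw [Sq_wordProd_cons, map_add]
    match m with
    | 0 => simp only [homogeneousComponent_zero_X_mul, add_zero]
    | 1 =>
      simp only [homogeneousComponent_succ_X_mul, homogeneousComponent_zero_X_mul, mul_zero,
        add_zero]
      rw [ih (by simpa using h), mul_zero]
    | m + 2 =>
      simp only [List.length_cons] at h
      simp only [homogeneousComponent_succ_X_mul]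
      rw [ih (by omega), ih (by omega)]
      simp only [mul_zero, add_zero]

/-- The substitution of `T ^ w j` for the variable `x_j`. -/
def kronecker (w : Fin 5 → ℕ) : P5 →ₐ[ZMod 2] PowerSeries (ZMod 2) :=
  aeval fun j => PowerSeries.X ^ w j

/-- The image of the `r`-th Steenrod square of a word under a Kronecker substitution, where `ws`
lists the exponents substituted for the letters of the word. -/
def sqBits (ws : List ℕ) : ℕ → ℕ :=
  List.rec (fun r => Nat.rec 1 (fun _ _ => 0) r)
    (fun w _ ih r => Nat.rec (Nat.shiftLeft (ih 0) w)
      (fun r _ => Nat.xor (Nat.shiftLeft (ih r.succ) w) (Nat.shiftLeft (ih r) (Nat.mul 2 w))) r) ws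

theorem kronecker_homogeneousComponent_Sq_wordProd (w : Fin 5 → ℕ) (js : List (Fin 5)) (r : ℕ) :
    kronecker w (homogeneousComponent (js.length + r) (Sq (wordProd js))) =
      bits (sqBits (js.map w) r) := by
  induction js generalizing r with
  | nil =>
    have hone : Sq (wordProd []) = C 1 := by simp [wordProd]
    rw [hone]
    cases r with
    | zero =>
      rw [List.length_nil, zero_add, homogeneousComponent_zero, coeff_zero_C, map_one, map_one]
      exact bits_one.symm
    | succ r =>
      rw [List.length_nil, zero_add, homogeneousComponent_of_mem (isHomogeneous_C _ _),
        if_neg r.succ_ne_zero, map_zero]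
      exact bits_zero.symm
  | cons j js ih =>
    have hX : kronecker w (X j) = PowerSeries.X ^ w j := aeval_X _ _
    rw [Sq_wordProd_cons, map_add, map_add, List.length_cons, add_right_comm,
      homogeneousComponent_succ_X_mul, homogeneousComponent_succ_X_mul, map_mul, map_mul, ih, hX]
    cases r with
    | zero =>
      have hlow : homogeneousComponent (js.length + 0) (X j * Sq (wordProd js)) = 0 := by
        cases hn : js.length with
        | zero => exact homogeneousComponent_zero_X_mul _ _
        | succ n =>
          rw [add_zero, homogeneousComponent_succ_X_mul,
            homogeneousComponent_Sq_wordProd_of_lt (by omega), mul_zero]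
      rw [hlow, map_zero, mul_zero, add_zero]
      exact (bits_shiftLeft _ _).symm
    | succ r =>
      rw [← add_assoc, homogeneousComponent_succ_X_mul, map_mul, ih, hX, ← mul_assoc, ← pow_add,
        ← two_mul, ← bits_shiftLeft, ← bits_shiftLeft, ← bits_xor]
      rfl

/-- The letters of the monomial with exponents `x`, listed by their values under `f`. -/
def wordOf {α : Type} (f : Fin 5 → α) (x : Fin 5 → ℕ) : List α :=
  (List.finRange 5).flatMap fun j => List.replicate (x j) (f j)

theorem map_wordOf {α : Type} (f : Fin 5 → α) (x : Fin 5 → ℕ) :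
    (wordOf id x).map f = wordOf f x := by
  simp [wordOf, List.map_flatMap]

theorem length_wordOf (x : Fin 5 → ℕ) : (wordOf id x).length = ∑ j, x j := by
  simp [wordOf, List.length_flatMap, Fin.sum_univ_def]

theorem wordProd_wordOf (m : Fin 5 →₀ ℕ) : wordProd (wordOf id m) = monomial m 1 := by
  rw [monomial_eq, map_one, one_mul, Finsupp.prod_fintype _ _ fun _ => pow_zero _, wordProd,
    map_wordOf]
  simp [wordOf, Fin.prod_univ_def, List.flatMap, List.prod_flatten, Function.comp_def]

/-! ### An injective encoding of the polynomials of degree `9` -/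

/-- Weights which separate the monomials of degree `9`. -/
def separatingWeight : Fin 5 → ℕ := ![1, 10, 100, 1000, 0]

/-- Small weights; they only serve to spread the low-order bits of the encodings, by which the
kernel hashes numbers. -/
def hashWeight : Fin 5 → ℕ := ![0, 2, 3, 5, 7]

/-- The encoding of polynomials of degree `9` by bit vectors. -/
def encode : P5 →ₗ[ZMod 2] PowerSeries (ZMod 2) :=
  LinearMap.mulLeft (ZMod 2) (PowerSeries.X ^ 64) ∘ₗ (kronecker separatingWeight).toLinearMap +
    (kronecker hashWeight).toLinearMap

theorem encode_apply (p : P5) :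
    encode p = PowerSeries.X ^ 64 * kronecker separatingWeight p + kronecker hashWeight p :=
  rfl

theorem kronecker_monomial (w : Fin 5 → ℕ) (d : Fin 5 →₀ ℕ) (a : ZMod 2) :
    kronecker w (monomial d a) = PowerSeries.monomial (∑ j, w j * d j) a := by
  rw [kronecker, aeval_monomial, Finsupp.prod_fintype _ _ fun _ => pow_zero _]
  simp only [← pow_mul, Finset.prod_pow_eq_pow_sum]
  rw [PowerSeries.monomial_eq_C_mul_X_pow]
  rfl

theorem coeff_encode_monomial {d e : Fin 5 →₀ ℕ} (hd : d.degree = 9) (he : e.degree = 9)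
    (a : ZMod 2) :
    PowerSeries.coeff (∑ j, separatingWeight j * e j + 64) (encode (monomial d a)) =
      if d = e then a else 0 := by
  rw [Finsupp.degree_eq_sum, Fin.sum_univ_five] at hd he
  rw [encode_apply, kronecker_monomial, kronecker_monomial, map_add, add_comm _ 64,
    PowerSeries.coeff_X_pow_mul', if_pos (Nat.le_add_right _ _), Nat.add_sub_cancel_left,
    PowerSeries.coeff_monomial, PowerSeries.coeff_monomial]
  simp only [Fin.sum_univ_five, separatingWeight, hashWeight, Matrix.cons_val]
  have hlow : ¬64 + (1 * e 0 + 10 * e 1 + 100 * e 2 + 1000 * e 3 + 0 * e 4) =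
      0 * d 0 + 2 * d 1 + 3 * d 2 + 5 * d 3 + 7 * d 4 := by omega
  rw [if_neg hlow, add_zero]
  refine if_congr ⟨fun h => ?_, fun h => by rw [h]⟩ rfl rfl
  have h3 : d 3 = e 3 := by omega
  have h2 : d 2 = e 2 := by omega
  have h1 : d 1 = e 1 := by omega
  have h0 : d 0 = e 0 := by omega
  have h4 : d 4 = e 4 := by omega
  ext j
  fin_cases j <;> assumption

theorem coeff_encode {p : P5} (hp : p.IsHomogeneous 9) {e : Fin 5 →₀ ℕ} (he : e.degree = 9) :
    PowerSeries.coeff (∑ j, separatingWeight j * e j + 64) (encode p) = coeff e p := by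
  conv_lhs => rw [p.as_sum, map_sum, map_sum]
  rw [Finset.sum_congr rfl fun d hd => coeff_encode_monomial
    (by rw [Finsupp.degree_eq_weight_one]; exact hp (mem_support_iff.mp hd)) he _]
  simp [eq_comm]

theorem encode_injective :
    Function.Injective (encode ∘ₗ (homogeneousSubmodule (Fin 5) (ZMod 2) 9).subtype) := by
  rw [injective_iff_map_eq_zero]
  rintro ⟨p, hp⟩ h
  ext e
  by_cases he : e.degree = 9
  · change coeff e p = 0
    rw [← coeff_encode hp he, show encode p = 0 from h, map_zero]
  · exact IsHomogeneous.coeff_eq_zero hp he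

/-! ### The hit polynomials of degree `9` -/

/-- The encoding of the component of degree `|x| + r` of `Sq` of the monomial with exponents `x`. -/
def hitRow (x : Fin 5 → ℕ) (r : ℕ) : ℕ :=
  Nat.xor (Nat.shiftLeft (sqBits (wordOf separatingWeight x) r) 64)
    (sqBits (wordOf hashWeight x) r)

/-- The encodings of the hit polynomials of degree `9` which come from monomials. -/
def hitRows : List ℕ :=
  (List.range 9).flatMap fun n =>
    (List.Nat.antidiagonalTuple 5 n).map fun x => hitRow x (9 - n)

theorem mem_hitRows {v : ℕ} :
    v ∈ hitRows ↔ ∃ m : Fin 5 →₀ ℕ, m.degree < 9 ∧ hitRow m (9 - m.degree) = v := by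
  simp only [hitRows, List.mem_flatMap, List.mem_range, List.mem_map,
    List.Nat.mem_antidiagonalTuple]
  constructor
  · rintro ⟨n, hn, x, rfl, rfl⟩
    refine ⟨Finsupp.equivFunOnFinite.symm x, ?_⟩
    simpa [Finsupp.degree_eq_sum] using hn
  · rintro ⟨m, hm, rfl⟩
    exact ⟨m.degree, hm, m, (Finsupp.degree_eq_sum m).symm, rfl⟩

theorem encode_homogeneousComponent_Sq_monomial {m : Fin 5 →₀ ℕ} (hm : m.degree < 9) :
    encode (homogeneousComponent 9 (Sq (monomial m 1))) = bits (hitRow m (9 - m.degree)) := by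
  have hlen : (wordOf id m).length + (9 - m.degree) = 9 := by
    rw [length_wordOf, ← Finsupp.degree_eq_sum]
    omega
  have hkr (w : Fin 5 → ℕ) : kronecker w (homogeneousComponent 9 (Sq (monomial m 1))) =
      bits (sqBits (wordOf w m) (9 - m.degree)) := by
    have h := kronecker_homogeneousComponent_Sq_wordProd w (wordOf id m) (9 - m.degree)
    rwa [hlen, wordProd_wordOf, map_wordOf] at h
  rw [encode_apply, hkr, hkr, ← bits_shiftLeft, ← bits_xor]
  rfl

theorem hitSpan_eq (n : ℕ) :
    hitSpan n = Submodule.span (ZMod 2)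
      ((fun m => homogeneousComponent n (Sq (monomial m 1))) '' {m | m.degree < n}) := by
  refine le_antisymm (Submodule.span_le.mpr ?_) (Submodule.span_mono ?_)
  · rintro _ ⟨g, hg, rfl⟩
    rw [g.as_sum, map_sum, map_sum]
    refine Submodule.sum_mem _ fun m hm => ?_
    have hdeg : m.degree < n := by
      by_contra! hle
      refine mem_support_iff.mp hm ?_
      rw [← coeff_zero m, ← hg _ hle, coeff_homogeneousComponent, if_pos rfl]
    rw [← mul_one (coeff m g), ← smul_eq_mul, ← smul_monomial, map_smul, map_smul]
    exact Submodule.smul_mem _ _ (Submodule.subset_span ⟨m, hdeg, rfl⟩)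
  · rintro _ ⟨m, hm, rfl⟩
    refine ⟨monomial m 1, fun k hk => homogeneousComponent_eq_zero' _ _ fun d hd => ?_, rfl⟩
    rw [Finset.mem_singleton.mp (support_monomial_subset hd)]
    exact (lt_of_lt_of_le hm hk).ne

theorem map_encode_hitSpan : (hitSpan 9).map encode = spanBits hitRows := by
  rw [hitSpan_eq, Submodule.map_span, spanBits, Set.image_image]
  congr 1
  ext y
  simp only [Set.mem_image, Set.mem_ofPred_eq, mem_hitRows]
  constructor
  · rintro ⟨m, hm, rfl⟩
    exact ⟨_, ⟨m, hm, rfl⟩, (encode_homogeneousComponent_Sq_monomial hm).symm⟩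
  · rintro ⟨_, ⟨m, hm, rfl⟩, rfl⟩
    exact ⟨m, hm, encode_homogeneousComponent_Sq_monomial hm⟩

theorem hitSpan_le (n : ℕ) : hitSpan n ≤ homogeneousSubmodule (Fin 5) (ZMod 2) n := by
  refine Submodule.span_le.mpr ?_
  rintro _ ⟨g, -, rfl⟩
  exact homogeneousComponent_isHomogeneous _ _

set_option maxRecDepth 100000 in
theorem elimRank_hitRows : elimRank hitRows [] = 524 := by
  decide +kernel

theorem finrank_comap_hitSpan :
    Module.finrank (ZMod 2)
      (Submodule.comap (homogeneousSubmodule (Fin 5) (ZMod 2) 9).subtype (hitSpan 9)) = 524 := by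
  rw [← elimRank_hitRows, ← finrank_spanBits, ← map_encode_hitSpan,
    (Submodule.equivMapOfInjective _ encode_injective _).finrank_eq, Submodule.map_comp,
    Submodule.map_comap_subtype, inf_eq_right.mpr (hitSpan_le 9)]

/-- The coordinates of a homogeneous polynomial with respect to the monomials of its degree. -/
def homogeneousSubmoduleEquiv (n : ℕ) :
    homogeneousSubmodule (Fin 5) (ZMod 2) n ≃ₗ[ZMod 2]
      ({d : Fin 5 →₀ ℕ | d.degree = n} →₀ ZMod 2) :=
  LinearEquiv.ofEq _ _ (homogeneousSubmodule_eq_finsupp_supported _ _ n) ≪≫ₗ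
    AddMonoidAlgebra.supportedEquivFinsupp _

instance finite_homogeneousSubmodule (n : ℕ) :
    Module.Finite (ZMod 2) (homogeneousSubmodule (Fin 5) (ZMod 2) n) := by
  have : Finite {d : Fin 5 →₀ ℕ | d.degree = n} :=
    (Finsupp.finite_of_degree_le n).subset fun d (hd : d.degree = n) => hd.le
  exact Module.Finite.equiv (homogeneousSubmoduleEquiv n).symm

theorem finrank_homogeneousSubmodule_nine :
    Module.finrank (ZMod 2) (homogeneousSubmodule (Fin 5) (ZMod 2) 9) = 715 := by
  have hset : {d : Fin 5 →₀ ℕ | d.degree = 9} =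
      (Finset.univ.finsuppAntidiag 9 : Finset (Fin 5 →₀ ℕ)) := by
    ext d
    simp [Finset.mem_finsuppAntidiag, Finsupp.degree_eq_sum]
  rw [(homogeneousSubmoduleEquiv 9).finrank_eq, hset]
  simp only [Finset.coe_sort_coe, Module.finrank_finsupp_self, Fintype.card_coe]
  rw [Finset.card_finsuppAntidiag_nat_eq_choose]
  decide

end HitProblem

/-- `dim_{F_2} (QP_5)_9 = 191`. -/
theorem stmt0 :
    Module.finrank (ZMod 2)
      (↥(homogeneousSubmodule (Fin 5) (ZMod 2) 9) ⧸
        Submodule.comap (homogeneousSubmodule (Fin 5) (ZMod 2) 9).subtype (hitSpan 9)) = 191 := by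
  have h := Submodule.finrank_quotient_add_finrank
    (Submodule.comap (homogeneousSubmodule (Fin 5) (ZMod 2) 9).subtype (hitSpan 9))
  rw [HitProblem.finrank_comap_hitSpan, HitProblem.finrank_homogeneousSubmodule_nine] at h
  exact Nat.add_right_cancel (h.trans (by norm_num : 715 = 191 + 524))
end
end

section
/- The F_2-vector space (QP_5)_23 has dimension 1245, i.e., the space of homogeneous polynomials of degree 23 in P_5 modulo hit polynomials has dimension 1245 over F_2. -/
open MvPolynomial

noncomputable section

namespace QP5

/-! ### Binary vectors encoded as natural numbers -/

/-- Vectors over `F_2`, indexed by bit positions. -/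
abbrev BitSpace : Type := ℕ → ZMod 2

/-- The vector whose coordinates are the binary digits of `n`. -/
def bv (n : ℕ) : BitSpace := fun i => if n.testBit i then 1 else 0

@[simp] lemma bv_zero : bv 0 = 0 := by
  funext i
  simp [bv]

@[simp] lemma bv_xor (m n : ℕ) : bv (m ^^^ n) = bv m + bv n := by
  funext i
  simp only [bv, Nat.testBit_xor, Pi.add_apply]
  cases m.testBit i <;> cases n.testBit i <;> simp
  decide

/-- Multiplication by `2 ^ n`, as a linear map on bit vectors. -/
def shiftMap (n : ℕ) : BitSpace →ₗ[ZMod 2] BitSpace where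
  toFun f i := if n ≤ i then f (i - n) else 0
  map_add' f g := by
    funext i
    by_cases h : n ≤ i <;> simp [h]
  map_smul' c f := by
    funext i
    by_cases h : n ≤ i <;> simp [h]

lemma shiftMap_bv (n v : ℕ) : shiftMap n (bv v) = bv (v <<< n) := by
  funext i
  by_cases h : n ≤ i <;> simp [shiftMap, bv, Nat.testBit_shiftLeft, h]

/-- The span of the bit vectors encoded by a list. -/
def spanL (l : List ℕ) : Submodule (ZMod 2) BitSpace :=
  Submodule.span (ZMod 2) {x | ∃ v ∈ l, x = bv v}

lemma bv_mem_spanL {l : List ℕ} {v : ℕ} (h : v ∈ l) : bv v ∈ spanL l :=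
  Submodule.subset_span ⟨v, h, rfl⟩

lemma spanL_le {l : List ℕ} {p : Submodule (ZMod 2) BitSpace} :
    spanL l ≤ p ↔ ∀ v ∈ l, bv v ∈ p := by
  rw [spanL, Submodule.span_le]
  constructor
  · intro h v hv
    exact h ⟨v, hv, rfl⟩
  · rintro h _ ⟨v, hv, rfl⟩
    exact h v hv

@[simp] lemma spanL_nil : spanL [] = ⊥ := by
  rw [eq_bot_iff, spanL_le]
  simp

lemma spanL_append (l m : List ℕ) : spanL (l ++ m) = spanL l ⊔ spanL m := by
  apply le_antisymm
  · rw [spanL_le]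
    intro v hv
    rcases List.mem_append.1 hv with h | h
    · exact Submodule.mem_sup_left (bv_mem_spanL h)
    · exact Submodule.mem_sup_right (bv_mem_spanL h)
  · refine sup_le ?_ ?_ <;> rw [spanL_le] <;> intro v hv <;> apply bv_mem_spanL <;> simp [hv]

lemma spanL_cons (v : ℕ) (l : List ℕ) : spanL (v :: l) = spanL [v] ⊔ spanL l :=
  spanL_append [v] l

lemma spanL_singleton_zero : spanL [0] = ⊥ := by
  rw [eq_bot_iff, spanL_le]
  simp

lemma sup_spanL_xor {p : Submodule (ZMod 2) BitSpace} {v w : ℕ} (hw : bv w ∈ p) :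
    p ⊔ spanL [v ^^^ w] = p ⊔ spanL [v] := by
  have key : ∀ a b : ℕ, bv b ∈ p → p ⊔ spanL [a ^^^ b] ≤ p ⊔ spanL [a] := by
    intro a b hb
    refine sup_le le_sup_left ?_
    rw [spanL_le]
    intro x hx
    rw [List.mem_singleton.1 hx, bv_xor]
    exact add_mem (Submodule.mem_sup_right (bv_mem_spanL (by simp))) (Submodule.mem_sup_left hb)
  refine le_antisymm (key v w hw) ?_
  have := key (v ^^^ w) w hw
  rwa [Nat.xor_assoc, Nat.xor_self, Nat.xor_zero] at this

instance finiteDimensional_spanL (l : List ℕ) : FiniteDimensional (ZMod 2) (spanL l) := by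
  apply FiniteDimensional.span_of_finite
  have : {x | ∃ v ∈ l, x = bv v} = bv '' {v | v ∈ l} := by
    ext x
    simp [eq_comm]
  rw [this]
  exact (List.finite_toSet l).image bv

/-! ### Gaussian elimination, in a form suited to evaluation by the kernel -/

/-- Applies `f` to `x`; the recursion on `x + 1` makes the kernel evaluate `x` first. -/
def force {α : Type} (x : ℕ) (f : ℕ → α) : α := Nat.rec (f 0) (fun n _ => f n) (Nat.add x 1)

@[simp] lemma force_eq {α : Type} (x : ℕ) (f : ℕ → α) : force x f = f x := rfl

/-- Search trees whose leaves hold the rows of an echelon form. -/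
inductive Trie
  | leaf (v : ℕ)
  | node (s : ℕ) (a b : Trie)

namespace Trie

/-- The leaf at the position belonging to `l`. -/
def get (t : Trie) (l : ℕ) : ℕ :=
  Trie.rec (fun v => v) (fun s _ _ x y => Bool.rec x y (Nat.ble s l)) t

/-- Overwrites the leaf at the position belonging to `l` by `l`. -/
def set (t : Trie) (l : ℕ) : Trie :=
  Trie.rec (fun _ => leaf l)
    (fun s a b x y => Bool.rec (node s x b) (node s a y) (Nat.ble s l)) t

/-- Reduces a row with respect to the stored rows and stores the result. -/
def ins (fuel : ℕ) : Trie → ℕ → Trie :=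
  Nat.rec (fun t v => node 0 t (leaf v))
    (fun _ ih t v => Nat.rec t
      (fun n _ => Nat.rec (set t (Nat.succ n))
        (fun w _ => ih t (Nat.xor (Nat.succ n) (Nat.succ w))) (get t (Nat.succ n))) v) fuel

/-- The empty search tree with leaves for the bit lengths `s + 1, …, s + 2 ^ k`. -/
def build (k : ℕ) : ℕ → Trie :=
  Nat.rec (fun _ => leaf 0)
    (fun k ih s =>
      node (Nat.pow 2 (Nat.add s (Nat.pow 2 k))) (ih s) (ih (Nat.add s (Nat.pow 2 k)))) k

/-- The nonzero leaves, prepended to a list. -/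
def toL (t : Trie) : List ℕ → List ℕ :=
  Trie.rec (fun v acc => Nat.rec acc (fun n _ => Nat.succ n :: acc) v)
    (fun _ _ _ x y acc => x (y acc)) t

/-- The span of the leaves. -/
def span (t : Trie) : Submodule (ZMod 2) BitSpace :=
  Trie.rec (fun v => spanL [v]) (fun _ _ _ x y => x ⊔ y) t

lemma span_node (s : ℕ) (a b : Trie) : (node s a b).span = a.span ⊔ b.span := rfl

lemma get_node (s : ℕ) (a b : Trie) (l : ℕ) :
    (node s a b).get l = if s ≤ l then b.get l else a.get l := by
  change (Bool.rec (a.get l) (b.get l) (Nat.ble s l) : ℕ) = _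
  by_cases h : s ≤ l
  · rw [if_pos h, Nat.ble_eq_true_of_le h]
  · rw [if_neg h, Bool.eq_false_of_not_eq_true fun h' => h (Nat.le_of_ble_eq_true h')]

lemma set_node (s : ℕ) (a b : Trie) (l : ℕ) :
    (node s a b).set l = if s ≤ l then node s a (b.set l) else node s (a.set l) b := by
  change (Bool.rec (node s (a.set l) b) (node s a (b.set l)) (Nat.ble s l) : Trie) = _
  by_cases h : s ≤ l
  · rw [if_pos h, Nat.ble_eq_true_of_le h]
  · rw [if_neg h, Bool.eq_false_of_not_eq_true fun h' => h (Nat.le_of_ble_eq_true h')]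

lemma bv_get_mem (t : Trie) (l : ℕ) : bv (t.get l) ∈ t.span := by
  induction t with
  | leaf v => exact bv_mem_spanL (by simp [get])
  | node s a b iha ihb =>
    rw [get_node, span_node]
    split_ifs
    · exact Submodule.mem_sup_right ihb
    · exact Submodule.mem_sup_left iha

lemma span_set {t : Trie} {l : ℕ} (h : t.get l = 0) : (t.set l).span = t.span ⊔ spanL [l] := by
  induction t with
  | leaf v =>
    change v = 0 at h
    subst h
    change spanL [l] = spanL [0] ⊔ spanL [l]
    rw [spanL_singleton_zero, bot_sup_eq]
  | node s a b iha ihb =>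
    rw [get_node] at h
    rw [set_node]
    split_ifs at h ⊢
    · rw [span_node, span_node, ihb h, sup_assoc]
    · rw [span_node, span_node, iha h, sup_right_comm]

lemma span_ins (fuel : ℕ) (t : Trie) (v : ℕ) : (ins fuel t v).span = t.span ⊔ spanL [v] := by
  induction fuel generalizing v with
  | zero => rfl
  | succ k ih =>
    cases v with
    | zero =>
      change t.span = _
      rw [spanL_singleton_zero, sup_bot_eq]
    | succ n =>
      have hg := bv_get_mem t (n + 1)
      change (Nat.rec (t.set (n + 1)) (fun w _ => ins k t ((n + 1) ^^^ (w + 1)))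
        (t.get (n + 1)) : Trie).span = _
      cases hw : t.get (n + 1) with
      | zero => exact span_set hw
      | succ w =>
        rw [hw] at hg
        change (ins k t ((n + 1) ^^^ (w + 1))).span = _
        rw [ih, sup_spanL_xor hg]

lemma span_build (k s : ℕ) : (build k s).span = ⊥ := by
  induction k generalizing s with
  | zero => exact spanL_singleton_zero
  | succ k ih =>
    change (build k s).span ⊔ (build k (s + 2 ^ k)).span = ⊥
    rw [ih, ih, bot_sup_eq]

lemma spanL_toL (t : Trie) (acc : List ℕ) : spanL (t.toL acc) = t.span ⊔ spanL acc := by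
  induction t generalizing acc with
  | leaf v =>
    cases v with
    | zero =>
      change spanL acc = spanL [0] ⊔ spanL acc
      rw [spanL_singleton_zero, bot_sup_eq]
    | succ n => exact spanL_cons (n + 1) acc
  | node s a b iha ihb =>
    change spanL (a.toL (b.toL acc)) = a.span ⊔ b.span ⊔ spanL acc
    rw [iha, ihb, sup_assoc]

/-- Inserts all rows of a list; the inner recursion makes the kernel evaluate the tree at each
step. -/
def insAll (rows : List ℕ) : Trie → Trie :=
  List.rec (fun t => t)
    (fun v _ ih t => Trie.rec (fun v => ih (leaf v)) (fun s a b _ _ => ih (node s a b))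
      (force v (ins 20000 t))) rows

lemma span_insAll (rows : List ℕ) (t : Trie) : (insAll rows t).span = t.span ⊔ spanL rows := by
  induction rows generalizing t with
  | nil => simp [insAll]
  | cons v l ih =>
    have : insAll (v :: l) t = insAll l (ins 20000 t v) := by
      change (Trie.rec (fun v => insAll l (leaf v)) (fun s a b _ _ => insAll l (node s a b))
        (ins 20000 t v) : Trie) = _
      cases ins 20000 t v <;> rfl
    rw [this, ih, span_ins, spanL_cons v l, sup_assoc]

end Trie

/-- An echelon form of a list of rows of bit length at most `2 ^ k`. -/
def echelon (k : ℕ) (rows : List ℕ) : List ℕ := (Trie.insAll rows (Trie.build k 0)).toL []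

lemma spanL_echelon (k : ℕ) (rows : List ℕ) : spanL (echelon k rows) = spanL rows := by
  rw [echelon, Trie.spanL_toL, Trie.span_insAll, Trie.span_build, spanL_nil, bot_sup_eq, sup_bot_eq]

/-- Clears in `v` the leading bits of the rows of `l`. -/
def reduce (l : List ℕ) : ℕ → ℕ :=
  List.rec (fun v => v)
    (fun r _ ih v => force (Nat.xor v r) fun w => ih (Bool.rec v w (Nat.ble w v))) l

/-- Moves the rows of the first list to the second one, reducing each one by the earlier ones. -/
def reduceAll (l : List ℕ) : List ℕ → List ℕ :=
  List.rec (fun acc => acc) (fun v _ ih acc => force (reduce acc v) fun w => ih (w :: acc)) l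

lemma sup_spanL_reduce {p : Submodule (ZMod 2) BitSpace} {l : List ℕ} (hl : spanL l ≤ p) (v : ℕ) :
    p ⊔ spanL [reduce l v] = p ⊔ spanL [v] := by
  induction l generalizing v with
  | nil => rfl
  | cons r l ih =>
    rw [spanL_cons, sup_le_iff] at hl
    change p ⊔ spanL [reduce l (Bool.rec v (v ^^^ r) (Nat.ble (v ^^^ r) v))] = _
    rw [ih hl.2]
    cases Nat.ble (v ^^^ r) v
    · rfl
    · exact sup_spanL_xor (hl.1 (bv_mem_spanL (by simp)))

lemma spanL_reduceAll (l acc : List ℕ) : spanL (reduceAll l acc) = spanL acc ⊔ spanL l := by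
  induction l generalizing acc with
  | nil => simp [reduceAll]
  | cons v l ih =>
    change spanL (reduceAll l (reduce acc v :: acc)) = _
    rw [ih, spanL_cons, sup_comm (spanL [_]), sup_spanL_reduce le_rfl, spanL_cons v l, sup_assoc]

/-- Checks that `l` consists of `c` numbers of strictly increasing bit length, all of them greater
than the bit length of `p`. -/
def isEchelon (l : List ℕ) : ℕ → ℕ → Bool :=
  List.rec (fun _ c => Nat.beq c 0)
    (fun v _ ih p c => Nat.rec false
      (fun c _ => Bool.rec false
        (Bool.rec false (ih v c) (Nat.ble (Nat.succ p) (Nat.xor v p)))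
        (Nat.ble (Nat.succ p) v)) c) l

lemma isEchelon_cons {v : ℕ} {l : List ℕ} {p c : ℕ} (h : isEchelon (v :: l) p c = true) :
    p < v ∧ p < v ^^^ p ∧ ∃ d, c = d + 1 ∧ isEchelon l v d = true := by
  cases c with
  | zero => cases h
  | succ d =>
    change (Bool.rec false (Bool.rec false (isEchelon l v d)
      (Nat.ble (p + 1) (v ^^^ p))) (Nat.ble (p + 1) v) : Bool) = true at h
    cases h₁ : Nat.ble (p + 1) v with
    | false => rw [h₁] at h; cases h
    | true =>
      cases h₂ : Nat.ble (p + 1) (v ^^^ p) with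
      | false => rw [h₁, h₂] at h; cases h
      | true =>
        rw [h₁, h₂] at h
        exact ⟨Nat.le_of_ble_eq_true h₁, Nat.le_of_ble_eq_true h₂, d, rfl, h⟩

lemma lt_two_pow_log2_of_lt_xor {p v : ℕ} (h : p < v) (hx : p < v ^^^ p) : p < 2 ^ v.log2 := by
  by_contra! hp
  have hv : v < 2 ^ (v.log2 + 1) := Nat.lt_log2_self
  have hpv : p.log2 = v.log2 := by
    rw [Nat.log2_eq_iff (by have := Nat.two_pow_pos v.log2; omega)]
    exact ⟨hp, h.trans hv⟩
  have hb : v ^^^ p < 2 ^ v.log2 := by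
    apply Nat.lt_pow_two_of_testBit
    intro i hi
    rcases hi.eq_or_lt with rfl | hi
    · have h₁ := Nat.testBit_log2 (n := v) (by omega)
      have h₂ := Nat.testBit_log2 (n := p) (by have := Nat.two_pow_pos v.log2; omega)
      rw [hpv] at h₂
      rw [Nat.testBit_xor, h₁, h₂]
      rfl
    · have hle : 2 ^ (v.log2 + 1) ≤ 2 ^ i := Nat.pow_le_pow_right (by norm_num) hi
      rw [Nat.testBit_xor, Nat.testBit_lt_two_pow (hv.trans_le hle),
        Nat.testBit_lt_two_pow ((h.trans hv).trans_le hle)]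
      rfl
  omega

lemma finrank_sup_spanL {l : List ℕ} {p c : ℕ} (h : isEchelon l p c = true)
    (U : Submodule (ZMod 2) BitSpace) [FiniteDimensional (ZMod 2) U]
    (hU : ∀ x ∈ U, ∀ i, p < 2 ^ i → x i = 0) :
    Module.finrank (ZMod 2) ↥(U ⊔ spanL l) = Module.finrank (ZMod 2) U + l.length ∧
      l.length = c := by
  induction l generalizing p c U with
  | nil =>
    rw [spanL_nil, sup_bot_eq]
    exact ⟨rfl, (Nat.eq_of_beq_eq_true h).symm⟩
  | cons v l ih =>
    obtain ⟨hpv, hx, d, rfl, hl⟩ := isEchelon_cons h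
    have hlog := lt_two_pow_log2_of_lt_xor hpv hx
    have hbit : bv v v.log2 = 1 := by
      rw [bv, Nat.testBit_log2 (by omega), if_pos rfl]
    have hsingle : spanL [v] = Submodule.span (ZMod 2) {bv v} := by
      rw [spanL]
      congr 1
      ext x
      simp
    have hinf : U ⊓ spanL [v] = ⊥ := by
      rw [eq_bot_iff]
      rintro x ⟨hxU, hxv⟩
      rw [hsingle, SetLike.mem_coe, Submodule.mem_span_singleton] at hxv
      obtain ⟨a, rfl⟩ := hxv
      have := hU _ hxU _ hlog
      rw [Pi.smul_apply, hbit, smul_eq_mul, mul_one] at this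
      rw [this, zero_smul]
      exact zero_mem _
    have hne : bv v ≠ 0 := fun h₀ => by
      rw [h₀] at hbit
      exact zero_ne_one hbit
    have hrank := Submodule.finrank_sup_add_finrank_inf_eq U (spanL [v])
    rw [hinf, finrank_bot, hsingle, finrank_span_singleton hne, ← hsingle, add_zero] at hrank
    have hU' : ∀ x ∈ U ⊔ spanL [v], ∀ i, v < 2 ^ i → x i = 0 := by
      intro x hx i hi
      rw [hsingle] at hx
      obtain ⟨y, hy, z, hz, rfl⟩ := Submodule.mem_sup.1 hx
      obtain ⟨a, rfl⟩ := Submodule.mem_span_singleton.1 hz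
      rw [Pi.add_apply, hU y hy i (hpv.trans hi), Pi.smul_apply, bv, Nat.testBit_lt_two_pow hi]
      simp
    obtain ⟨h₁, h₂⟩ := ih hl (U ⊔ spanL [v]) hU'
    rw [spanL_cons, ← sup_assoc, h₁, hrank, List.length_cons]
    omega

lemma finrank_spanL {l : List ℕ} {c : ℕ} (h : isEchelon l 0 c = true) :
    Module.finrank (ZMod 2) (spanL l) = c ∧ l.length = c := by
  have := finrank_sup_spanL h ⊥ (by simp)
  rw [bot_sup_eq, finrank_bot, zero_add] at this
  exact ⟨this.1.trans this.2, this.2⟩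

/-! ### Enumerations -/

/-- The list `[0, 1, …, n]`. -/
def upto (n : ℕ) : List ℕ := Nat.rec (fun l => 0 :: l) (fun n ih l => ih (Nat.succ n :: l)) n []

/-- Concatenates the lists `f a b c d e` for all `a + b + c + d + e = n`, followed by `l`. -/
def comps {α : Type} (n : ℕ) (f : ℕ → ℕ → ℕ → ℕ → ℕ → List α) (l : List α) : List α :=
  List.rec l (fun s _ r => List.rec r (fun t _ r => List.rec r (fun u _ r => List.rec r
    (fun a _ r => (f a (Nat.sub u a) (Nat.sub t u) (Nat.sub s t) (Nat.sub n s)).append r)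
    (upto u)) (upto t)) (upto s)) (upto n)

/-- Concatenates the lists `f a b c d e` for all `a + b + c + d + e ≤ n`. -/
def compsLe {α : Type} (n : ℕ) (f : ℕ → ℕ → ℕ → ℕ → ℕ → List α) : List α :=
  List.rec [] (fun m _ r => comps m f r) (upto n)

/-- The numbers `k` for which `a.choose k` is odd. -/
def odds (a : ℕ) : List ℕ :=
  List.rec [] (fun k _ r => Bool.rec r (k :: r) (Nat.beq (Nat.land a k) k)) (upto a)

/-- The sum modulo two, digit by digit, of the `f a` for `a` in `l`. -/
def xorSum (l : List ℕ) (f : ℕ → ℕ) : ℕ := List.rec 0 (fun a _ ih => Nat.xor (f a) ih) l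

/-- The image of the total square of the monomial with exponents `a, b, c, d, e` under the linear
map whose value on a monomial is given by `f`. -/
def sqSum (f : ℕ → ℕ → ℕ → ℕ → ℕ → ℕ) (a b c d e : ℕ) : ℕ :=
  xorSum (odds a) fun i => force (Nat.add a i) fun a =>
  xorSum (odds b) fun i => force (Nat.add b i) fun b =>
  xorSum (odds c) fun i => force (Nat.add c i) fun c =>
  xorSum (odds d) fun i => force (Nat.add d i) fun d =>
  xorSum (odds e) fun i => force (Nat.add e i) fun e => f a b c d e

/-! ### Codes of monomials -/

/-- A numbering of the exponent vectors of a fixed degree; the last exponent is omitted. -/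
def index (a b c d : ℕ) : ℕ :=
  force (Nat.add a b) fun u => force (Nat.add u c) fun t => force (Nat.add t d) fun s =>
  Nat.add (Nat.div (Nat.mul (Nat.mul s (Nat.add s 1)) (Nat.mul (Nat.add s 2) (Nat.add s 3))) 24)
    (Nat.add (Nat.div (Nat.mul (Nat.mul t (Nat.add t 1)) (Nat.add t 2)) 6)
      (Nat.add (Nat.div (Nat.mul u (Nat.add u 1)) 2) a))

/-- A number of bit length `x + 33` whose lower bits are spread out: rows with such leading entries
are mostly distinguished by their low bits. -/
def spread (x : ℕ) : ℕ :=
  force x fun x => Nat.add (Nat.pow 2 (Nat.add 32 x)) (Nat.mod (Nat.mul x 2654435761) 4294967296)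

/-- The code of an exponent vector. -/
def code (a b c d : ℕ) : ℕ := spread (index a b c d)

/-- The sum of five exponents. -/
def deg (a b c d e : ℕ) : ℕ := Nat.add a (Nat.add b (Nat.add c (Nat.add d e)))

/-- The code of an exponent vector of degree `n`, and `0` in other degrees. -/
def codeDeg (n a b c d e : ℕ) : ℕ := Bool.rec 0 (code a b c d) (Nat.beq (deg a b c d e) n)

/-- Injective linear maps, indexed by `k`, with independent ranges on vectors of bounded length. -/
def phi (k t : ℕ) : ℕ :=
  force t fun t => Nat.xor (Nat.xor t (Nat.shiftLeft t (Nat.succ k)))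
    (Nat.shiftLeft t (Nat.mul 1050 (Nat.succ k)))

/-- The code of the part of `x_1 ⋯ x_5 (1 + x_1) ⋯ (1 + x_5) g ^ 2` in degree `23` with at least
three odd exponents, for the monomial `g` with exponents `a, b, c, d, e`. -/
def code5 (a b c d e : ℕ) : ℕ :=
  force (deg a b c d e) fun n => Bool.rec
    (Bool.rec 0 (phi 10 (code a b c d)) (Nat.beq n 9))
    (Nat.xor (phi 0 (code a b c (Nat.succ d)))
    (Nat.xor (phi 1 (code a b (Nat.succ c) d))
    (Nat.xor (phi 2 (code a b (Nat.succ c) (Nat.succ d)))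
    (Nat.xor (phi 3 (code a (Nat.succ b) c d))
    (Nat.xor (phi 4 (code a (Nat.succ b) c (Nat.succ d)))
    (Nat.xor (phi 5 (code a (Nat.succ b) (Nat.succ c) d))
    (Nat.xor (phi 6 (code (Nat.succ a) b c d))
    (Nat.xor (phi 7 (code (Nat.succ a) b c (Nat.succ d)))
    (Nat.xor (phi 8 (code (Nat.succ a) b (Nat.succ c) d))
      (phi 9 (code (Nat.succ a) (Nat.succ b) c d)))))))))))
    (Nat.beq n 8)

/-! ### The matrices -/

/-- The relations in degree `10`. -/
def rows10 : List ℕ := compsLe 9 fun a b c d e => [sqSum (codeDeg 10) a b c d e]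

/-- A reduced echelon form of the relations in degree `10`. -/
def basis10 : List ℕ := reduceAll (echelon 11 rows10) []

/-- The images of the members of a list under `phi 0, …, phi 9`. -/
def phiAll (l : List ℕ) : List ℕ :=
  List.rec [] (fun v _ r => List.rec r (fun k _ r => phi k v :: r) (upto 9)) l

/-- The relations coming from monomials with three odd exponents. -/
def rows3 : List ℕ := phiAll basis10

/-- The relations coming from monomials with four odd exponents. -/
def rows4 : List ℕ := comps 9 (fun a b c d e =>
  force (codeDeg 10 (Nat.succ a) b c d e) fun x₁ =>
  force (codeDeg 10 a (Nat.succ b) c d e) fun x₂ =>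
  force (codeDeg 10 a b (Nat.succ c) d e) fun x₃ =>
  force (codeDeg 10 a b c (Nat.succ d) e) fun x₄ =>
  force (codeDeg 10 a b c d (Nat.succ e)) fun x₅ =>
    [Nat.xor (phi 0 x₄) (Nat.xor (phi 1 x₃) (Nat.xor (phi 3 x₂) (phi 6 x₁))),
    Nat.xor (phi 0 x₅) (Nat.xor (phi 2 x₃) (Nat.xor (phi 4 x₂) (phi 7 x₁))),
    Nat.xor (phi 1 x₅) (Nat.xor (phi 2 x₄) (Nat.xor (phi 5 x₂) (phi 8 x₁))),
    Nat.xor (phi 3 x₅) (Nat.xor (phi 4 x₄) (Nat.xor (phi 5 x₃) (phi 9 x₁))),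
    Nat.xor (phi 6 x₅) (Nat.xor (phi 7 x₄) (Nat.xor (phi 8 x₃) (phi 9 x₂)))]) []

/-- The relations coming from monomials with five odd exponents. -/
def rows5 : List ℕ := compsLe 8 fun a b c d e => [sqSum code5 a b c d e]

/-- All relations. -/
def relations : List ℕ := (rows3.append rows4).append rows5

/-- The codes of the monomials of degree `23` with at least three odd exponents. -/
def codes : List ℕ :=
  List.rec (comps 9 (fun a b c d _ => [phi 10 (code a b c d)]) [])
    (fun k _ r => comps 10 (fun a b c d _ => [phi k (code a b c d)]) r) (upto 9)

set_option maxRecDepth 100000 in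
lemma isEchelon_codes : isEchelon codes 0 10725 = true := by
  decide +kernel

set_option maxRecDepth 100000 in
lemma isEchelon_relations : isEchelon (echelon 14 relations) 0 9480 = true := by
  decide +kernel

/-! ### Properties of the enumerations -/

lemma rec_eq_flatMap {α β : Type} {F : β → List α → List α} {G : β → List α}
    (h : ∀ s r, F s r = G s ++ r) (l : List α) (L : List β) :
    (List.rec l (fun s _ r => F s r) L : List α) = L.flatMap G ++ l := by
  induction L with
  | nil => rfl
  | cons s L ih =>
    change F s (List.rec l (fun s _ r => F s r) L) = _
    rw [ih, h, List.flatMap_cons, List.append_assoc]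

lemma upto_eq (n : ℕ) : upto n = List.range (n + 1) := by
  have key : ∀ l, (Nat.rec (fun l => 0 :: l) (fun n ih l => ih (Nat.succ n :: l)) n :
      List ℕ → List ℕ) l = List.range (n + 1) ++ l := by
    induction n with
    | zero => intro l; rfl
    | succ n ih =>
      intro l
      rw [List.range_succ, List.append_assoc]
      exact ih (Nat.succ n :: l)
  exact (key []).trans (List.append_nil _)

@[simp] lemma mem_upto {n k : ℕ} : k ∈ upto n ↔ k ≤ n := by
  rw [upto_eq, List.mem_range, Nat.lt_succ_iff]

lemma comps_eq {α : Type} (n : ℕ) (f : ℕ → ℕ → ℕ → ℕ → ℕ → List α) (l : List α) :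
    comps n f l = ((upto n).flatMap fun s => (upto s).flatMap fun t => (upto t).flatMap fun u =>
      (upto u).flatMap fun a => f a (u - a) (t - u) (s - t) (n - s)) ++ l := by
  refine rec_eq_flatMap (fun s r => ?_) l _
  refine rec_eq_flatMap (fun t r => ?_) r _
  refine rec_eq_flatMap (fun u r => ?_) r _
  exact rec_eq_flatMap (fun a r => rfl) r _

lemma mem_comps {α : Type} {n : ℕ} {f : ℕ → ℕ → ℕ → ℕ → ℕ → List α} {l : List α} {x : α} :
    x ∈ comps n f l ↔ (∃ a b c d e, a + b + c + d + e = n ∧ x ∈ f a b c d e) ∨ x ∈ l := by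
  simp only [comps_eq, List.mem_append, List.mem_flatMap, mem_upto]
  refine or_congr_left ⟨?_, ?_⟩
  · rintro ⟨s, hs, t, ht, u, hu, a, ha, hx⟩
    refine ⟨_, _, _, _, _, ?_, hx⟩
    omega
  · rintro ⟨a, b, c, d, e, rfl, hx⟩
    refine ⟨a + b + c + d, by omega, a + b + c, by omega, a + b, by omega, a, by omega, ?_⟩
    simpa only [Nat.add_sub_cancel_left] using hx

lemma map_comps_congr {α β γ : Type} {g : α → γ} {g' : β → γ} {n : ℕ}
    {f : ℕ → ℕ → ℕ → ℕ → ℕ → List α} {f' : ℕ → ℕ → ℕ → ℕ → ℕ → List β} {l : List α} {l' : List β}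
    (h : ∀ a b c d e, a + b + c + d + e = n → (f a b c d e).map g = (f' a b c d e).map g')
    (hl : l.map g = l'.map g') : (comps n f l).map g = (comps n f' l').map g' := by
  simp only [comps_eq, List.map_append, List.map_flatMap, hl]
  congr 1
  refine List.flatMap_congr fun s hs => List.flatMap_congr fun t ht => List.flatMap_congr
    fun u hu => List.flatMap_congr fun a ha => h _ _ _ _ _ ?_
  rw [mem_upto] at hs ht hu ha
  omega

lemma mem_compsLe {α : Type} {n : ℕ} {f : ℕ → ℕ → ℕ → ℕ → ℕ → List α} {x : α} :
    x ∈ compsLe n f ↔ ∃ a b c d e, a + b + c + d + e ≤ n ∧ x ∈ f a b c d e := by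
  have : compsLe n f = ((upto n).flatMap fun m => comps m f []) ++ [] :=
    rec_eq_flatMap (fun m r => by rw [comps_eq, comps_eq, List.append_nil]) [] _
  simp only [this, List.append_nil, List.mem_flatMap, mem_upto, mem_comps, List.not_mem_nil,
    or_false]
  constructor
  · rintro ⟨m, hm, a, b, c, d, e, rfl, hx⟩
    exact ⟨a, b, c, d, e, hm, hx⟩
  · rintro ⟨a, b, c, d, e, hm, hx⟩
    exact ⟨_, hm, a, b, c, d, e, rfl, hx⟩

lemma odds_eq (a : ℕ) : odds a = (List.range (a + 1)).filter fun k => Nat.beq (Nat.land a k) k := by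
  rw [← upto_eq, odds]
  induction upto a with
  | nil => rfl
  | cons k l ih =>
    rw [List.filter_cons, ← ih]
    change (Bool.rec _ _ (Nat.beq (Nat.land a k) k) : List ℕ) = _
    cases Nat.beq (Nat.land a k) k <;> rfl

lemma odds_eq_cons (a : ℕ) : ∃ l, odds a = 0 :: l ∧ ∀ k ∈ l, k ≠ 0 := by
  rw [odds_eq, List.range_succ_eq_map, List.filter_cons_of_pos (by simp)]
  refine ⟨_, rfl, fun k hk => ?_⟩
  obtain ⟨j, -, rfl⟩ := List.mem_map.1 (List.mem_filter.1 hk).1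
  exact j.succ_ne_zero

lemma bv_xorSum (l : List ℕ) (f : ℕ → ℕ) : bv (xorSum l f) = (l.map fun i => bv (f i)).sum := by
  induction l with
  | nil => exact bv_zero
  | cons a l ih =>
    rw [List.map_cons, List.sum_cons, ← ih, ← bv_xor]
    rfl

lemma xorSum_eq_zero {l : List ℕ} {f : ℕ → ℕ} (h : ∀ i ∈ l, f i = 0) : xorSum l f = 0 := by
  induction l with
  | nil => rfl
  | cons a l ih =>
    change f a ^^^ xorSum l f = 0
    rw [h a (by simp), ih fun i hi => h i (by simp [hi]), Nat.xor_self]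

lemma xorSum_odds {a : ℕ} {f : ℕ → ℕ} (h : ∀ i, i ≠ 0 → f i = 0) : xorSum (odds a) f = f 0 := by
  obtain ⟨l, hl, hl₀⟩ := odds_eq_cons a
  rw [hl]
  change f 0 ^^^ xorSum l f = f 0
  rw [xorSum_eq_zero fun i hi => h i (hl₀ i hi), Nat.xor_zero]

lemma sqSum_eq (f : ℕ → ℕ → ℕ → ℕ → ℕ → ℕ) (a b c d e : ℕ) : sqSum f a b c d e =
    xorSum (odds a) fun i => xorSum (odds b) fun j => xorSum (odds c) fun k =>
    xorSum (odds d) fun l => xorSum (odds e) fun m => f (a + i) (b + j) (c + k) (d + l) (e + m) :=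
  rfl

lemma sqSum_eq_self {f : ℕ → ℕ → ℕ → ℕ → ℕ → ℕ} {a b c d e : ℕ}
    (h : ∀ a' b' c' d' e', a + b + c + d + e < a' + b' + c' + d' + e' → f a' b' c' d' e' = 0) :
    sqSum f a b c d e = f a b c d e := by
  rw [sqSum_eq, xorSum_odds, xorSum_odds, xorSum_odds, xorSum_odds, xorSum_odds]
  · rfl
  all_goals intro i hi
  · exact h _ _ _ _ _ (by omega)
  · exact xorSum_eq_zero fun m _ => h _ _ _ _ _ (by omega)
  · exact xorSum_eq_zero fun l _ => xorSum_eq_zero fun m _ => h _ _ _ _ _ (by omega)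
  · exact xorSum_eq_zero fun k _ => xorSum_eq_zero fun l _ => xorSum_eq_zero fun m _ =>
      h _ _ _ _ _ (by omega)
  · exact xorSum_eq_zero fun j _ => xorSum_eq_zero fun k _ => xorSum_eq_zero fun l _ =>
      xorSum_eq_zero fun m _ => h _ _ _ _ _ (by omega)

lemma bv_xorSum_mem {p : Submodule (ZMod 2) BitSpace} {l : List ℕ} {f : ℕ → ℕ}
    (h : ∀ i ∈ l, bv (f i) ∈ p) : bv (xorSum l f) ∈ p := by
  rw [bv_xorSum]
  apply list_sum_mem
  simpa using h

lemma bv_sqSum_mem {p : Submodule (ZMod 2) BitSpace} {f : ℕ → ℕ → ℕ → ℕ → ℕ → ℕ}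
    (h : ∀ a b c d e, bv (f a b c d e) ∈ p) (a b c d e : ℕ) : bv (sqSum f a b c d e) ∈ p :=
  bv_xorSum_mem fun _ _ => bv_xorSum_mem fun _ _ => bv_xorSum_mem fun _ _ =>
    bv_xorSum_mem fun _ _ => bv_xorSum_mem fun _ _ => h _ _ _ _ _

/-! ### Properties of the codes -/

lemma beq_eq_false {m n : ℕ} (h : m ≠ n) : Nat.beq m n = false :=
  Bool.eq_false_iff.2 fun h' => h (Nat.eq_of_beq_eq_true h')

lemma deg_eq (a b c d e : ℕ) : deg a b c d e = a + b + c + d + e := by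
  simp only [deg, Nat.add_eq]
  omega

lemma codeDeg_of_eq {n a b c d e : ℕ} (h : a + b + c + d + e = n) :
    codeDeg n a b c d e = code a b c d := by
  rw [codeDeg, deg_eq, h, Nat.beq_refl]

lemma codeDeg_of_ne {n a b c d e : ℕ} (h : a + b + c + d + e ≠ n) : codeDeg n a b c d e = 0 := by
  rw [codeDeg, deg_eq, beq_eq_false h]

/-- The linear map given by `phi k` on binary vectors. -/
def phiMap (k : ℕ) : BitSpace →ₗ[ZMod 2] BitSpace :=
  LinearMap.id + shiftMap (k + 1) + shiftMap (1050 * (k + 1))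

lemma phiMap_bv (k v : ℕ) : phiMap k (bv v) = bv (phi k v) := by
  simp only [phiMap, LinearMap.add_apply, LinearMap.id_apply, shiftMap_bv, ← bv_xor]
  rfl

@[simp] lemma phi_zero (k : ℕ) : phi k 0 = 0 := by
  change 0 ^^^ 0 <<< (k + 1) ^^^ 0 <<< (1050 * (k + 1)) = 0
  simp

lemma bv_sqSum_phi (k : ℕ) (f : ℕ → ℕ → ℕ → ℕ → ℕ → ℕ) (a b c d e : ℕ) :
    bv (sqSum (fun a b c d e => phi k (f a b c d e)) a b c d e) =
      phiMap k (bv (sqSum f a b c d e)) := by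
  simp only [sqSum_eq, bv_xorSum, map_list_sum, List.map_map, Function.comp_def, phiMap_bv]

lemma code5_eq (a b c d e : ℕ) : code5 a b c d e =
    phi 10 (codeDeg 9 a b c d e) ^^^
    (phi 0 (codeDeg 10 a b c (d + 1) (e + 1)) ^^^ (phi 1 (codeDeg 10 a b (c + 1) d (e + 1)) ^^^
    (phi 2 (codeDeg 10 a b (c + 1) (d + 1) e) ^^^ (phi 3 (codeDeg 10 a (b + 1) c d (e + 1)) ^^^
    (phi 4 (codeDeg 10 a (b + 1) c (d + 1) e) ^^^ (phi 5 (codeDeg 10 a (b + 1) (c + 1) d e) ^^^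
    (phi 6 (codeDeg 10 (a + 1) b c d (e + 1)) ^^^ (phi 7 (codeDeg 10 (a + 1) b c (d + 1) e) ^^^
    (phi 8 (codeDeg 10 (a + 1) b (c + 1) d e) ^^^
      phi 9 (codeDeg 10 (a + 1) (b + 1) c d e)))))))))) := by
  change (Bool.rec (Bool.rec 0 (phi 10 (code a b c d)) (Nat.beq (deg a b c d e) 9)) _
    (Nat.beq (deg a b c d e) 8) : ℕ) = _
  rw [deg_eq]
  by_cases h₈ : a + b + c + d + e = 8
  · rw [codeDeg_of_ne (n := 9) (by omega), codeDeg_of_eq (by omega), codeDeg_of_eq (by omega),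
      codeDeg_of_eq (by omega), codeDeg_of_eq (by omega), codeDeg_of_eq (by omega),
      codeDeg_of_eq (by omega), codeDeg_of_eq (by omega), codeDeg_of_eq (by omega),
      codeDeg_of_eq (by omega), codeDeg_of_eq (by omega), h₈, phi_zero, Nat.zero_xor]
    rfl
  · rw [codeDeg_of_ne (n := 10) (by omega), codeDeg_of_ne (n := 10) (by omega),
      codeDeg_of_ne (n := 10) (by omega), codeDeg_of_ne (n := 10) (by omega),
      codeDeg_of_ne (n := 10) (by omega), codeDeg_of_ne (n := 10) (by omega),
      codeDeg_of_ne (n := 10) (by omega), codeDeg_of_ne (n := 10) (by omega),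
      codeDeg_of_ne (n := 10) (by omega), codeDeg_of_ne (n := 10) (by omega), beq_eq_false h₈]
    simp only [phi_zero, Nat.xor_self, Nat.xor_zero]
    by_cases h₉ : a + b + c + d + e = 9
    · rw [codeDeg_of_eq h₉, h₉]
      rfl
    · rw [codeDeg_of_ne h₉, phi_zero, beq_eq_false h₉]

/-! ### The linear map detecting classes in degree 23 -/

/-- The code of the monomial with exponents `2 * a + s₁, …, 2 * e + s₅`; it vanishes unless the
degree is `23` and at least three exponents are odd. -/
def monCode : Bool → Bool → Bool → Bool → Bool → ℕ → ℕ → ℕ → ℕ → ℕ → ℕ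
  | true, true, true, false, false => fun a b c d e => phi 0 (codeDeg 10 a b c d e)
  | true, true, false, true, false => fun a b c d e => phi 1 (codeDeg 10 a b c d e)
  | true, true, false, false, true => fun a b c d e => phi 2 (codeDeg 10 a b c d e)
  | true, false, true, true, false => fun a b c d e => phi 3 (codeDeg 10 a b c d e)
  | true, false, true, false, true => fun a b c d e => phi 4 (codeDeg 10 a b c d e)
  | true, false, false, true, true => fun a b c d e => phi 5 (codeDeg 10 a b c d e)
  | false, true, true, true, false => fun a b c d e => phi 6 (codeDeg 10 a b c d e)
  | false, true, true, false, true => fun a b c d e => phi 7 (codeDeg 10 a b c d e)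
  | false, true, false, true, true => fun a b c d e => phi 8 (codeDeg 10 a b c d e)
  | false, false, true, true, true => fun a b c d e => phi 9 (codeDeg 10 a b c d e)
  | true, true, true, true, true => fun a b c d e => phi 10 (codeDeg 9 a b c d e)
  | _, _, _, _, _ => fun _ _ _ _ _ => 0

lemma monCode_eq_zero {s₁ s₂ s₃ s₄ s₅ : Bool} {a b c d e : ℕ}
    (h : Nat.bit s₁ a + Nat.bit s₂ b + Nat.bit s₃ c + Nat.bit s₄ d + Nat.bit s₅ e ≠ 23) :
    monCode s₁ s₂ s₃ s₄ s₅ a b c d e = 0 := by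
  simp only [Nat.bit_val] at h
  cases s₁ <;> cases s₂ <;> cases s₃ <;> cases s₄ <;> cases s₅ <;>
    simp only [Bool.toNat_true, Bool.toNat_false] at h <;>
    first
    | rfl
    | (simp only [monCode]
       rw [codeDeg_of_ne (by omega), phi_zero])

lemma monomial_eq_mon (d : Fin 5 →₀ ℕ) :
    (monomial d 1 : P5) = mon (d 0) (d 1) (d 2) (d 3) (d 4) := by
  rw [monomial_eq, Finsupp.prod_fintype _ _ fun i => pow_zero _, Fin.prod_univ_five, C_1, one_mul,
    mon]

/-- The exponent vector with the given entries. -/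
def exponents (a b c d e : ℕ) : Fin 5 →₀ ℕ := Finsupp.equivFunOnFinite.symm ![a, b, c, d, e]

lemma mon_eq_monomial (a b c d e : ℕ) : mon a b c d e = monomial (exponents a b c d e) 1 := by
  rw [monomial_eq_mon]
  simp [exponents]

/-- The code of the monomial with exponent vector `d`. -/
def monomialCode (d : Fin 5 →₀ ℕ) : ℕ :=
  monCode (d 0).bodd (d 1).bodd (d 2).bodd (d 3).bodd (d 4).bodd
    (d 0).div2 (d 1).div2 (d 2).div2 (d 3).div2 (d 4).div2

/-- The linear map sending each monomial to the binary vector given by its code. -/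
def codeMap : P5 →ₗ[ZMod 2] BitSpace :=
  (basisMonomials (Fin 5) (ZMod 2)).constr (ZMod 2) fun d => bv (monomialCode d)

lemma codeMap_monomial (d : Fin 5 →₀ ℕ) : codeMap (monomial d 1) = bv (monomialCode d) := by
  have h := Module.Basis.constr_basis (basisMonomials (Fin 5) (ZMod 2)) (ZMod 2)
    (fun d => bv (monomialCode d)) d
  rwa [coe_basisMonomials] at h

lemma codeMap_mon (s₁ s₂ s₃ s₄ s₅ : Bool) (a b c d e : ℕ) :
    codeMap (mon (Nat.bit s₁ a) (Nat.bit s₂ b) (Nat.bit s₃ c) (Nat.bit s₄ d) (Nat.bit s₅ e)) =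
      bv (monCode s₁ s₂ s₃ s₄ s₅ a b c d e) := by
  rw [mon_eq_monomial, codeMap_monomial]
  simp [monomialCode, exponents]

lemma exists_bit_eq (n : ℕ) : ∃ s a, n = Nat.bit s a :=
  ⟨n.bodd, n.div2, (Nat.bit_bodd_div2 n).symm⟩

lemma degree_eq_sum (d : Fin 5 →₀ ℕ) : d.degree = d 0 + d 1 + d 2 + d 3 + d 4 := by
  rw [Finsupp.degree_eq_sum, Fin.sum_univ_five]

lemma codeMap_monomial_of_ne {d : Fin 5 →₀ ℕ} (h : d.degree ≠ 23) :
    codeMap (monomial d 1) = 0 := by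
  rw [degree_eq_sum] at h
  obtain ⟨s₁, a, h₁⟩ := exists_bit_eq (d 0)
  obtain ⟨s₂, b, h₂⟩ := exists_bit_eq (d 1)
  obtain ⟨s₃, c, h₃⟩ := exists_bit_eq (d 2)
  obtain ⟨s₄, e, h₄⟩ := exists_bit_eq (d 3)
  obtain ⟨s₅, f, h₅⟩ := exists_bit_eq (d 4)
  rw [h₁, h₂, h₃, h₄, h₅] at h
  rw [monomial_eq_mon, h₁, h₂, h₃, h₄, h₅, codeMap_mon, monCode_eq_zero h, bv_zero]

lemma codeMap_homogeneousComponent (f : P5) :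
    codeMap (homogeneousComponent 23 f) = codeMap f := by
  induction f using MvPolynomial.induction_on' with
  | monomial d r =>
    rw [homogeneousComponent_of_mem (isHomogeneous_monomial r rfl)]
    split_ifs with h
    · rfl
    · rw [map_zero, ← mul_one r, ← smul_eq_mul, ← smul_monomial, map_smul,
        codeMap_monomial_of_ne (Ne.symm h), smul_zero]
  | add p q hp hq => rw [map_add, map_add, map_add, hp, hq]

/-! ### The total square of a monomial -/

lemma choose_odd_iff : ∀ a < 12, ∀ k < 12, ((a.choose k : ZMod 2) =
    if Nat.beq (Nat.land a k) k then 1 else 0) := by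
  decide

lemma add_sq_pow (y : P5) {a : ℕ} (ha : a ≤ 11) :
    (y + y ^ 2) ^ a = ((odds a).map fun k => y ^ (a + k)).sum := by
  have h : (y + y ^ 2) ^ a = y ^ a * (y + 1) ^ a := by
    rw [← mul_pow]
    ring
  have key : ∀ n ≤ 12, ((((List.range n).filter fun k => Nat.beq (Nat.land a k) k).map
      fun k => y ^ (a + k)).sum = ∑ k ∈ Finset.range n, y ^ a * (y ^ k * (a.choose k : P5))) := by
    intro n hn
    induction n with
    | zero => rfl
    | succ n ih =>
      rw [List.range_succ, List.filter_append, List.map_append, List.sum_append, ih (by omega),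
        Finset.sum_range_succ, List.filter_singleton]
      congr 1
      have hc := congrArg (C (σ := Fin 5)) (choose_odd_iff a (by omega) n (by omega))
      rw [map_natCast] at hc
      rw [hc]
      cases Nat.beq (Nat.land a n) n <;> simp [pow_add]
  rw [h, add_pow, odds_eq, key _ (by omega), Finset.mul_sum]
  simp

/-- The total square of `x_i ^ (2 * a + s)`, up to replacing `a` by all `a + k` for which
`a.choose k` is odd. -/
def sqFactor (i : Fin 5) : Bool → ℕ → P5
  | false, a => X i ^ Nat.bit false a
  | true, a => X i ^ Nat.bit true a + X i ^ Nat.bit false (a + 1)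

lemma Sq_X_pow (i : Fin 5) (s : Bool) {a : ℕ} (ha : a ≤ 11) :
    Sq (X i ^ Nat.bit s a) = ((odds a).map fun k => sqFactor i s (a + k)).sum := by
  have hX : Sq (X i) = X i + X i ^ 2 := aeval_X _ i
  have hsq : ((X i + X i ^ 2) ^ 2 : P5) = X i ^ 2 + (X i ^ 2) ^ 2 := by
    rw [CharTwo.add_sq]
  rw [map_pow, hX, Nat.bit_val, pow_add, pow_mul, hsq, add_sq_pow _ ha, ← List.sum_map_mul_right]
  congr 2
  funext k
  cases s
  · simp [sqFactor, Nat.bit_val, pow_mul]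
  · simp only [sqFactor, Nat.bit_val, Bool.toNat_true, Bool.toNat_false]
    ring

/-- The linear extension of `F` to products with a factor `sqFactor i s a`. -/
def sqStep : Bool → (Bool → ℕ → ℕ) → ℕ → ℕ
  | false, F, a => F false a
  | true, F, a => F true a ^^^ F false (a + 1)

/-- The code of a product of factors `sqFactor`. -/
def sqCode (s₁ s₂ s₃ s₄ s₅ : Bool) (a b c d e : ℕ) : ℕ :=
  sqStep s₁ (fun s₁ a => sqStep s₂ (fun s₂ b => sqStep s₃ (fun s₃ c => sqStep s₄ (fun s₄ d =>
    sqStep s₅ (fun s₅ e => monCode s₁ s₂ s₃ s₄ s₅ a b c d e) e) d) c) b) a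

lemma bv_sqStep {p q : P5} {i : Fin 5} {F : Bool → ℕ → ℕ}
    (h : ∀ s a, codeMap (p * (X i ^ Nat.bit s a * q)) = bv (F s a)) (s : Bool) (a : ℕ) :
    codeMap (p * (sqFactor i s a * q)) = bv (sqStep s F a) := by
  cases s with
  | false => exact h false a
  | true => rw [sqFactor, sqStep, add_mul, mul_add, map_add, h, h, bv_xor]

lemma codeMap_sqFactor (s₁ s₂ s₃ s₄ s₅ : Bool) (a b c d e : ℕ) :
    codeMap (sqFactor 0 s₁ a * (sqFactor 1 s₂ b * (sqFactor 2 s₃ c * (sqFactor 3 s₄ d *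
      sqFactor 4 s₅ e)))) = bv (sqCode s₁ s₂ s₃ s₄ s₅ a b c d e) := by
  have h := bv_sqStep (p := 1) (q := sqFactor 1 s₂ b * sqFactor 2 s₃ c * sqFactor 3 s₄ d *
    sqFactor 4 s₅ e) (i := 0) (F := fun s₁ a => sqStep s₂ (fun s₂ b => sqStep s₃ (fun s₃ c =>
      sqStep s₄ (fun s₄ d => sqStep s₅ (fun s₅ e => monCode s₁ s₂ s₃ s₄ s₅ a b c d e) e) d) c) b)
    ?_ s₁ a
  · rw [sqCode, ← h]
    congr 1
    ring
  intro s₁ a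
  have h := bv_sqStep (p := X 0 ^ Nat.bit s₁ a) (q := sqFactor 2 s₃ c * sqFactor 3 s₄ d *
    sqFactor 4 s₅ e) (i := 1) (F := fun s₂ b => sqStep s₃ (fun s₃ c =>
      sqStep s₄ (fun s₄ d => sqStep s₅ (fun s₅ e => monCode s₁ s₂ s₃ s₄ s₅ a b c d e) e) d) c)
    ?_ s₂ b
  · rw [← h]
    congr 1
    ring
  intro s₂ b
  have h := bv_sqStep (p := X 0 ^ Nat.bit s₁ a * X 1 ^ Nat.bit s₂ b) (q := sqFactor 3 s₄ d *
    sqFactor 4 s₅ e) (i := 2) (F := fun s₃ c =>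
      sqStep s₄ (fun s₄ d => sqStep s₅ (fun s₅ e => monCode s₁ s₂ s₃ s₄ s₅ a b c d e) e) d)
    ?_ s₃ c
  · rw [← h]
    congr 1
    ring
  intro s₃ c
  have h := bv_sqStep (p := X 0 ^ Nat.bit s₁ a * X 1 ^ Nat.bit s₂ b * X 2 ^ Nat.bit s₃ c)
    (q := sqFactor 4 s₅ e) (i := 3)
    (F := fun s₄ d => sqStep s₅ (fun s₅ e => monCode s₁ s₂ s₃ s₄ s₅ a b c d e) e) ?_ s₄ d
  · rw [← h]
    congr 1
    ring
  intro s₄ d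
  have h := bv_sqStep (p := X 0 ^ Nat.bit s₁ a * X 1 ^ Nat.bit s₂ b * X 2 ^ Nat.bit s₃ c *
    X 3 ^ Nat.bit s₄ d) (q := 1) (i := 4) (F := fun s₅ e => monCode s₁ s₂ s₃ s₄ s₅ a b c d e)
    ?_ s₅ e
  · rw [← h]
    congr 1
    ring
  intro s₅ e
  rw [← codeMap_mon, mon, mul_one]

lemma codeMap_Sq_mon (s₁ s₂ s₃ s₄ s₅ : Bool) {a b c d e : ℕ} (ha : a ≤ 11) (hb : b ≤ 11)
    (hc : c ≤ 11) (hd : d ≤ 11) (he : e ≤ 11) :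
    codeMap (Sq (mon (Nat.bit s₁ a) (Nat.bit s₂ b) (Nat.bit s₃ c) (Nat.bit s₄ d)
      (Nat.bit s₅ e))) = bv (sqSum (sqCode s₁ s₂ s₃ s₄ s₅) a b c d e) := by
  simp only [mon, map_mul, Sq_X_pow _ _ ha, Sq_X_pow _ _ hb, Sq_X_pow _ _ hc, Sq_X_pow _ _ hd,
    Sq_X_pow _ _ he, mul_assoc, ← List.sum_map_mul_right]
  simp only [← List.sum_map_mul_left, map_list_sum, List.map_map, Function.comp_def,
    codeMap_sqFactor, sqSum_eq, bv_xorSum]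

/-! ### The image of the hit polynomials -/

lemma isHit_homogeneousComponent_Sq {d : Fin 5 →₀ ℕ} {n : ℕ} (h : d.degree < n) :
    homogeneousComponent n (Sq (monomial d 1)) ∈ hitSpan n := by
  refine Submodule.subset_span ⟨monomial d 1, fun m hm => ?_, rfl⟩
  rw [homogeneousComponent_of_mem (isHomogeneous_monomial 1 rfl), if_neg (by omega)]

lemma bv_sqSum_mem_map (s₁ s₂ s₃ s₄ s₅ : Bool) {a b c d e : ℕ}
    (h : Nat.bit s₁ a + Nat.bit s₂ b + Nat.bit s₃ c + Nat.bit s₄ d + Nat.bit s₅ e < 23) :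
    bv (sqSum (sqCode s₁ s₂ s₃ s₄ s₅) a b c d e) ∈ (hitSpan 23).map codeMap := by
  have h' := h
  simp only [Nat.bit_val] at h'
  rw [← codeMap_Sq_mon _ _ _ _ _ (by omega) (by omega) (by omega) (by omega) (by omega),
    ← codeMap_homogeneousComponent, mon_eq_monomial]
  refine Submodule.mem_map_of_mem (isHit_homogeneousComponent_Sq ?_)
  rw [degree_eq_sum]
  simpa [exponents] using h

lemma map_codeMap_hitSpan_le {p : Submodule (ZMod 2) BitSpace}
    (h : ∀ s₁ s₂ s₃ s₄ s₅ a b c d e,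
      Nat.bit s₁ a + Nat.bit s₂ b + Nat.bit s₃ c + Nat.bit s₄ d + Nat.bit s₅ e < 23 →
      bv (sqSum (sqCode s₁ s₂ s₃ s₄ s₅) a b c d e) ∈ p) :
    (hitSpan 23).map codeMap ≤ p := by
  rw [Submodule.map_le_iff_le_comap, hitSpan, Submodule.span_le]
  rintro _ ⟨g, hg, rfl⟩
  change codeMap _ ∈ p
  rw [codeMap_homogeneousComponent, g.as_sum, map_sum, map_sum]
  refine sum_mem fun x hx => ?_
  have hx23 : x.degree < 23 := by
    by_contra! hle
    have := congrArg (coeff x) (hg _ hle)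
    rw [coeff_homogeneousComponent, if_pos rfl, coeff_zero] at this
    exact mem_support_iff.1 hx this
  rw [← mul_one (coeff x g), ← smul_eq_mul, ← smul_monomial, map_smul, map_smul, monomial_eq_mon]
  refine Submodule.smul_mem _ _ ?_
  rw [degree_eq_sum] at hx23
  obtain ⟨s₁, a, h₁⟩ := exists_bit_eq (x 0)
  obtain ⟨s₂, b, h₂⟩ := exists_bit_eq (x 1)
  obtain ⟨s₃, c, h₃⟩ := exists_bit_eq (x 2)
  obtain ⟨s₄, d, h₄⟩ := exists_bit_eq (x 3)
  obtain ⟨s₅, e, h₅⟩ := exists_bit_eq (x 4)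
  rw [h₁, h₂, h₃, h₄, h₅] at hx23 ⊢
  have h' := hx23
  simp only [Nat.bit_val] at h'
  rw [codeMap_Sq_mon _ _ _ _ _ (by omega) (by omega) (by omega) (by omega) (by omega)]
  exact h _ _ _ _ _ _ _ _ _ _ hx23

lemma spanL_basis10 : spanL basis10 = spanL rows10 := by
  rw [basis10, spanL_reduceAll, spanL_nil, bot_sup_eq, spanL_echelon]

lemma mem_phiAll {v : ℕ} {l : List ℕ} : v ∈ phiAll l ↔ ∃ w ∈ l, ∃ k ≤ 9, v = phi k w := by
  have : phiAll l = (l.flatMap fun w => (upto 9).flatMap fun k => [phi k w]) ++ [] := by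
    refine rec_eq_flatMap (G := fun w => (upto 9).flatMap fun k => [phi k w]) (fun w r => ?_) [] l
    exact rec_eq_flatMap (F := fun k r => phi k w :: r) (G := fun k => [phi k w])
      (fun k r => rfl) r (upto 9)
  simp [this]

lemma spanL_rows3_le {p : Submodule (ZMod 2) BitSpace} : spanL rows3 ≤ p ↔
    ∀ k ≤ 9, ∀ a b c d e, a + b + c + d + e ≤ 9 →
      bv (sqSum (fun a b c d e => phi k (codeDeg 10 a b c d e)) a b c d e) ∈ p := by
  have h₁ : spanL rows3 ≤ p ↔ ∀ k ≤ 9, spanL basis10 ≤ p.comap (phiMap k) := by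
    simp only [spanL_le, rows3, mem_phiAll, Submodule.mem_comap, phiMap_bv]
    constructor
    · intro h k hk w hw
      exact h _ ⟨w, hw, k, hk, rfl⟩
    · rintro h _ ⟨w, hw, k, hk, rfl⟩
      exact h k hk w hw
  rw [h₁]
  simp only [spanL_basis10, spanL_le, rows10, mem_compsLe, List.mem_singleton, Submodule.mem_comap]
  constructor
  · intro h k hk a b c d e hdeg
    rw [bv_sqSum_phi]
    exact h k hk _ ⟨a, b, c, d, e, hdeg, rfl⟩
  · rintro h k hk _ ⟨a, b, c, d, e, hdeg, rfl⟩
    rw [← bv_sqSum_phi]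
    exact h k hk a b c d e hdeg

lemma mem_rows4 {v : ℕ} : v ∈ rows4 ↔ ∃ a b c d e, a + b + c + d + e = 9 ∧
    (v = sqCode true true true true false a b c d e ∨
      v = sqCode true true true false true a b c d e ∨
      v = sqCode true true false true true a b c d e ∨
      v = sqCode true false true true true a b c d e ∨
      v = sqCode false true true true true a b c d e) := by
  rw [rows4, mem_comps]
  simp only [force_eq, List.mem_cons, List.not_mem_nil, or_false, sqCode, sqStep, monCode,
    Nat.xor_assoc, Nat.zero_xor, Nat.xor_zero]
  rfl

lemma sqCode_eq_zero (s₁ s₂ s₃ s₄ s₅ : Bool) {a b c d e : ℕ}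
    (hs : s₁.toNat + s₂.toNat + s₃.toNat + s₄.toNat + s₅.toNat = 4) (h : a + b + c + d + e ≠ 9) :
    sqCode s₁ s₂ s₃ s₄ s₅ a b c d e = 0 := by
  cases s₁ <;> cases s₂ <;> cases s₃ <;> cases s₄ <;> cases s₅ <;>
    simp only [Bool.toNat_true, Bool.toNat_false] at hs <;> try omega
  all_goals
    simp only [sqCode, sqStep, monCode, Nat.xor_assoc, Nat.zero_xor, Nat.xor_zero]
    repeat rw [codeDeg_of_ne (by omega)]
    simp only [phi_zero, Nat.xor_zero]

lemma bv_sqCode_mem_rows4 (s₁ s₂ s₃ s₄ s₅ : Bool) (a b c d e : ℕ)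
    (hs : s₁.toNat + s₂.toNat + s₃.toNat + s₄.toNat + s₅.toNat = 4) :
    bv (sqCode s₁ s₂ s₃ s₄ s₅ a b c d e) ∈ spanL rows4 := by
  by_cases h : a + b + c + d + e = 9
  · refine bv_mem_spanL (mem_rows4.2 ⟨a, b, c, d, e, h, ?_⟩)
    cases s₁ <;> cases s₂ <;> cases s₃ <;> cases s₄ <;> cases s₅ <;>
      first | contradiction | simp only [true_or, or_true]
  · rw [sqCode_eq_zero _ _ _ _ _ hs h, bv_zero]
    exact zero_mem _

lemma spanL_rows4_le {p : Submodule (ZMod 2) BitSpace}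
    (h : ∀ s₁ s₂ s₃ s₄ s₅ a b c d e, a + b + c + d + e = 9 →
      s₁.toNat + s₂.toNat + s₃.toNat + s₄.toNat + s₅.toNat = 4 →
      bv (sqSum (sqCode s₁ s₂ s₃ s₄ s₅) a b c d e) ∈ p) : spanL rows4 ≤ p := by
  have h' : ∀ s₁ s₂ s₃ s₄ s₅ a b c d e, a + b + c + d + e = 9 →
      s₁.toNat + s₂.toNat + s₃.toNat + s₄.toNat + s₅.toNat = 4 →
      bv (sqCode s₁ s₂ s₃ s₄ s₅ a b c d e) ∈ p := by
    intro s₁ s₂ s₃ s₄ s₅ a b c d e hdeg hs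
    rw [← sqSum_eq_self (f := sqCode s₁ s₂ s₃ s₄ s₅) fun _ _ _ _ _ hlt =>
      sqCode_eq_zero _ _ _ _ _ hs (by omega)]
    exact h _ _ _ _ _ _ _ _ _ _ hdeg hs
  rw [spanL_le]
  intro v hv
  obtain ⟨a, b, c, d, e, hdeg, rfl | rfl | rfl | rfl | rfl⟩ := mem_rows4.1 hv <;>
    exact h' _ _ _ _ _ _ _ _ _ _ hdeg rfl

lemma sqCode_of_all :
    sqCode true true true true true = code5 := by
  funext a b c d e
  simp only [sqCode, sqStep, monCode, Nat.xor_assoc, Nat.zero_xor, Nat.xor_zero, code5_eq]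

lemma sqCode_of_three {s₁ s₂ s₃ s₄ s₅ : Bool}
    (hs : s₁.toNat + s₂.toNat + s₃.toNat + s₄.toNat + s₅.toNat = 3) :
    ∃ k ≤ 9, sqCode s₁ s₂ s₃ s₄ s₅ = fun a b c d e => phi k (codeDeg 10 a b c d e) := by
  cases s₁ <;> cases s₂ <;> cases s₃ <;> cases s₄ <;> cases s₅ <;>
    first
    | contradiction
    | refine ⟨?_, ?_, ?_⟩
      rotate_left 2
      · funext a b c d e
        simp only [sqCode, sqStep, monCode, Nat.xor_zero]
        exact rfl
      · decide

lemma exists_sqCode_eq_phi {k : ℕ} (hk : k ≤ 9) : ∃ s₁ s₂ s₃ s₄ s₅ : Bool,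
    s₁.toNat + s₂.toNat + s₃.toNat + s₄.toNat + s₅.toNat = 3 ∧
    sqCode s₁ s₂ s₃ s₄ s₅ = fun a b c d e => phi k (codeDeg 10 a b c d e) := by
  interval_cases k
  · exact ⟨true, true, true, false, false, rfl, by
      funext; simp only [sqCode, sqStep, monCode, Nat.xor_zero]⟩
  · exact ⟨true, true, false, true, false, rfl, by
      funext; simp only [sqCode, sqStep, monCode, Nat.xor_zero]⟩
  · exact ⟨true, true, false, false, true, rfl, by
      funext; simp only [sqCode, sqStep, monCode, Nat.xor_zero]⟩
  · exact ⟨true, false, true, true, false, rfl, by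
      funext; simp only [sqCode, sqStep, monCode, Nat.xor_zero]⟩
  · exact ⟨true, false, true, false, true, rfl, by
      funext; simp only [sqCode, sqStep, monCode, Nat.xor_zero]⟩
  · exact ⟨true, false, false, true, true, rfl, by
      funext; simp only [sqCode, sqStep, monCode, Nat.xor_zero]⟩
  · exact ⟨false, true, true, true, false, rfl, by
      funext; simp only [sqCode, sqStep, monCode, Nat.xor_zero]⟩
  · exact ⟨false, true, true, false, true, rfl, by
      funext; simp only [sqCode, sqStep, monCode, Nat.xor_zero]⟩
  · exact ⟨false, true, false, true, true, rfl, by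
      funext; simp only [sqCode, sqStep, monCode, Nat.xor_zero]⟩
  · exact ⟨false, false, true, true, true, rfl, by
      funext; simp only [sqCode, sqStep, monCode, Nat.xor_zero]⟩

lemma sqCode_of_le_two {s₁ s₂ s₃ s₄ s₅ : Bool}
    (hs : s₁.toNat + s₂.toNat + s₃.toNat + s₄.toNat + s₅.toNat ≤ 2) :
    sqCode s₁ s₂ s₃ s₄ s₅ = fun _ _ _ _ _ => 0 := by
  cases s₁ <;> cases s₂ <;> cases s₃ <;> cases s₄ <;> cases s₅ <;>
    first
    | contradiction
    | funext a b c d e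
      simp only [sqCode, sqStep, monCode, Nat.xor_zero]

lemma spanL_relations : spanL relations = (hitSpan 23).map codeMap := by
  have hrel : spanL relations = spanL rows3 ⊔ spanL rows4 ⊔ spanL rows5 := by
    rw [← spanL_append, ← spanL_append]
    rfl
  apply le_antisymm
  · rw [hrel]
    refine sup_le (sup_le ?_ ?_) ?_
    · rw [spanL_rows3_le]
      intro k hk a b c d e hdeg
      obtain ⟨s₁, s₂, s₃, s₄, s₅, hs, hk⟩ := exists_sqCode_eq_phi hk
      rw [← hk]
      apply bv_sqSum_mem_map
      simp only [Nat.bit_val]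
      omega
    · apply spanL_rows4_le
      intro s₁ s₂ s₃ s₄ s₅ a b c d e hdeg hs
      apply bv_sqSum_mem_map
      simp only [Nat.bit_val]
      omega
    · rw [spanL_le]
      intro v hv
      obtain ⟨a, b, c, d, e, hdeg, hv⟩ := mem_compsLe.1 hv
      rw [List.mem_singleton.1 hv, ← sqCode_of_all]
      apply bv_sqSum_mem_map
      simp only [Nat.bit_val, Bool.toNat_true]
      omega
  · apply map_codeMap_hitSpan_le
    intro s₁ s₂ s₃ s₄ s₅ a b c d e h
    simp only [Nat.bit_val] at h
    rw [hrel]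
    obtain hs | hs | hs | hs : s₁.toNat + s₂.toNat + s₃.toNat + s₄.toNat + s₅.toNat ≤ 2 ∨
        s₁.toNat + s₂.toNat + s₃.toNat + s₄.toNat + s₅.toNat = 3 ∨
        s₁.toNat + s₂.toNat + s₃.toNat + s₄.toNat + s₅.toNat = 4 ∨
        5 ≤ s₁.toNat + s₂.toNat + s₃.toNat + s₄.toNat + s₅.toNat := by omega
    · refine bv_sqSum_mem (fun a b c d e => ?_) a b c d e
      rw [sqCode_of_le_two hs, bv_zero]
      exact zero_mem _
    · obtain ⟨k, hk, heq⟩ := sqCode_of_three hs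
      rw [heq]
      exact Submodule.mem_sup_left (Submodule.mem_sup_left
        (spanL_rows3_le.1 le_rfl k hk a b c d e (by omega)))
    · exact Submodule.mem_sup_left (Submodule.mem_sup_right (bv_sqSum_mem
        (fun a b c d e => bv_sqCode_mem_rows4 _ _ _ _ _ a b c d e hs) a b c d e))
    · have h₁ := s₁.toNat_le
      have h₂ := s₂.toNat_le
      have h₃ := s₃.toNat_le
      have h₄ := s₄.toNat_le
      have h₅ := s₅.toNat_le
      rw [Bool.toNat_eq_one.1 (by omega : s₁.toNat = 1),
        Bool.toNat_eq_one.1 (by omega : s₂.toNat = 1),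
        Bool.toNat_eq_one.1 (by omega : s₃.toNat = 1),
        Bool.toNat_eq_one.1 (by omega : s₄.toNat = 1),
        Bool.toNat_eq_one.1 (by omega : s₅.toNat = 1), sqCode_of_all]
      exact Submodule.mem_sup_right (bv_mem_spanL
        (mem_compsLe.2 ⟨a, b, c, d, e, by omega, List.mem_singleton_self _⟩))

/-! ### Monomials with one odd exponent -/

lemma monomial_mul_monomial (d e : Fin 5 →₀ ℕ) :
    (monomial d 1 * monomial e 1 : P5) = monomial (d + e) 1 := by
  rw [monomial_mul, one_mul]

open scoped Pointwise in
lemma mul_mem_restrictSupport {s t u : Set (Fin 5 →₀ ℕ)} {f g : P5}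
    (hf : f ∈ restrictSupport (ZMod 2) s) (hg : g ∈ restrictSupport (ZMod 2) t)
    (h : ∀ d ∈ s, ∀ e ∈ t, d + e ∈ u) : f * g ∈ restrictSupport (ZMod 2) u := by
  refine restrictSupport_mono _ (s := s + t) ?_ ?_
  · rintro _ ⟨d, hd, e, he, rfl⟩
    exact h d hd e he
  · rw [restrictSupport_add]
    exact Submodule.mul_mem_mul hf hg

lemma monomial_mem_restrictSupport {s : Set (Fin 5 →₀ ℕ)} {d : Fin 5 →₀ ℕ} (h : d ∈ s) :
    (monomial d 1 : P5) ∈ restrictSupport (ZMod 2) s := by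
  rw [mem_restrictSupport_iff]
  intro e he
  rw [Finset.mem_singleton.1 (support_monomial_subset he)]
  exact h

lemma homogeneousComponent_eq_zero_of_mem_restrictSupport {s : Set (Fin 5 →₀ ℕ)} {n : ℕ} {f : P5}
    (hf : f ∈ restrictSupport (ZMod 2) s) (h : ∀ d ∈ s, d.degree ≠ n) :
    homogeneousComponent n f = 0 :=
  homogeneousComponent_eq_zero' _ _ fun d hd => h d ((mem_restrictSupport_iff _).1 hf hd)

/-- The total square of a monomial is its square plus terms of lower degree. -/
lemma exists_Sq_monomial_eq (d : Fin 5 →₀ ℕ) :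
    ∃ r ∈ restrictSupport (ZMod 2) {e | d.degree ≤ e.degree ∧ e.degree < 2 * d.degree},
      Sq (monomial d 1) = monomial (d + d) 1 + r := by
  have hadd : ∀ d₁ d₂ : Fin 5 →₀ ℕ,
      (∃ r ∈ restrictSupport (ZMod 2) {e | d₁.degree ≤ e.degree ∧ e.degree < 2 * d₁.degree},
        Sq (monomial d₁ 1) = monomial (d₁ + d₁) 1 + r) →
      (∃ r ∈ restrictSupport (ZMod 2) {e | d₂.degree ≤ e.degree ∧ e.degree < 2 * d₂.degree},
        Sq (monomial d₂ 1) = monomial (d₂ + d₂) 1 + r) →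
      ∃ r ∈ restrictSupport (ZMod 2)
          {e | (d₁ + d₂).degree ≤ e.degree ∧ e.degree < 2 * (d₁ + d₂).degree},
        Sq (monomial (d₁ + d₂) 1) = monomial (d₁ + d₂ + (d₁ + d₂)) 1 + r := by
    rintro d₁ d₂ ⟨r₁, hr₁, h₁⟩ ⟨r₂, hr₂, h₂⟩
    have hm₁ := monomial_mem_restrictSupport (Set.mem_singleton (d₁ + d₁))
    have hm₂ := monomial_mem_restrictSupport (Set.mem_singleton (d₂ + d₂))
    refine ⟨monomial (d₁ + d₁) 1 * r₂ + r₁ * monomial (d₂ + d₂) 1 + r₁ * r₂,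
      add_mem (add_mem ?_ ?_) ?_, ?_⟩
    · refine mul_mem_restrictSupport hm₁ hr₂ fun x hx y hy => ?_
      simp only [Set.mem_singleton_iff, Set.mem_ofPred_eq, map_add] at hx hy ⊢
      rw [hx, map_add]
      omega
    · refine mul_mem_restrictSupport hr₁ hm₂ fun x hx y hy => ?_
      simp only [Set.mem_singleton_iff, Set.mem_ofPred_eq, map_add] at hx hy ⊢
      rw [hy, map_add]
      omega
    · refine mul_mem_restrictSupport hr₁ hr₂ fun x hx y hy => ?_
      simp only [Set.mem_ofPred_eq, map_add] at hx hy ⊢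
      omega
    · rw [← monomial_mul_monomial d₁, map_mul, h₁, h₂, add_add_add_comm,
        ← monomial_mul_monomial (d₁ + d₁)]
      ring
  have hzero : ∃ r ∈ restrictSupport (ZMod 2) {e | (0 : Fin 5 →₀ ℕ).degree ≤ e.degree ∧
      e.degree < 2 * (0 : Fin 5 →₀ ℕ).degree},
      Sq (monomial 0 1) = monomial (0 + 0) 1 + r :=
    ⟨0, zero_mem _, by simp⟩
  induction d using Finsupp.induction_linear with
  | zero => exact hzero
  | add d₁ d₂ h₁ h₂ => exact hadd d₁ d₂ h₁ h₂
  | single i k =>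
    induction k with
    | zero => simp
    | succ k ih =>
      rw [Finsupp.single_add]
      refine hadd _ _ ih ⟨X i, monomial_mem_restrictSupport (by simp), ?_⟩
      have hi : Sq (X i) = X i + X i ^ 2 := aeval_X _ i
      rw [← Finsupp.single_add, ← X_pow_eq_monomial, ← X_pow_eq_monomial, pow_one, hi, add_comm]

lemma X_mul_monomial_sq_mem_hitSpan (i : Fin 5) {d : Fin 5 →₀ ℕ} (hd : d.degree = 11) :
    X i * (monomial d 1) ^ 2 ∈ hitSpan 23 := by
  have hmem : ∀ k < 12, homogeneousComponent 23 (Sq (X i ^ k * monomial d 1)) ∈ hitSpan 23 := by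
    intro k hk
    rw [X_pow_eq_monomial, monomial_mul_monomial]
    apply isHit_homogeneousComponent_Sq
    rw [map_add, Finsupp.degree_single]
    omega
  have hX : ∀ k, (X i ^ k : P5) ∈ restrictSupport (ZMod 2) {Finsupp.single i k} := fun k => by
    rw [X_pow_eq_monomial]
    exact monomial_mem_restrictSupport (Set.mem_singleton _)
  have hsq : Sq (X i * monomial d 1) + Sq (X i ^ 2 * monomial d 1) +
      Sq (X i ^ 4 * monomial d 1) + Sq (X i ^ 8 * monomial d 1) =
      (X i + X i ^ 16) * Sq (monomial d 1) := by
    have hi : Sq (X i) = X i + X i ^ 2 := aeval_X _ i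
    have h₂ : ((X i + X i ^ 2) ^ 2 : P5) = X i ^ 2 + X i ^ 4 := by
      rw [CharTwo.add_sq]
      ring
    have h₄ : ((X i + X i ^ 2) ^ 4 : P5) = X i ^ 4 + X i ^ 8 := by
      rw [show 4 = 2 * 2 from rfl, pow_mul, h₂, CharTwo.add_sq]
      ring
    have h₈ : ((X i + X i ^ 2) ^ 8 : P5) = X i ^ 8 + X i ^ 16 := by
      rw [show 8 = 4 * 2 from rfl, pow_mul, h₄, CharTwo.add_sq]
      ring
    simp only [map_mul, map_pow, hi, h₂, h₄, h₈]
    linear_combination (X i ^ 2 + X i ^ 4 + X i ^ 8) * Sq (monomial d 1) *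
      CharTwo.two_eq_zero (R := P5)
  obtain ⟨r, hr, hdr⟩ := exists_Sq_monomial_eq d
  have hcomp : homogeneousComponent 23 ((X i + X i ^ 16) * Sq (monomial d 1)) =
      X i * (monomial d 1) ^ 2 := by
    have hd2 := monomial_mem_restrictSupport (Set.mem_singleton (d + d))
    have h₁ : homogeneousComponent 23 (X i * r) = 0 := by
      rw [← pow_one (X i)]
      refine homogeneousComponent_eq_zero_of_mem_restrictSupport
        (s := {e | e.degree < 23}) (mul_mem_restrictSupport (hX 1) hr fun x hx y hy => ?_)
        fun e he => ne_of_lt he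
      simp only [Set.mem_singleton_iff, Set.mem_ofPred_eq] at hx hy ⊢
      rw [map_add, hx, Finsupp.degree_single]
      omega
    have h₂ : homogeneousComponent 23 (X i ^ 16 * r) = 0 := by
      refine homogeneousComponent_eq_zero_of_mem_restrictSupport
        (s := {e | 23 < e.degree}) (mul_mem_restrictSupport (hX 16) hr fun x hx y hy => ?_)
        fun e he => ne_of_gt he
      simp only [Set.mem_singleton_iff, Set.mem_ofPred_eq] at hx hy ⊢
      rw [map_add, hx, Finsupp.degree_single]
      omega
    have h₃ : homogeneousComponent 23 (X i ^ 16 * monomial (d + d) 1 : P5) = 0 := by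
      refine homogeneousComponent_eq_zero_of_mem_restrictSupport
        (s := {e | 23 < e.degree}) (mul_mem_restrictSupport (hX 16) hd2 fun x hx y hy => ?_)
        fun e he => ne_of_gt he
      simp only [Set.mem_singleton_iff, Set.mem_ofPred_eq] at hx hy ⊢
      rw [map_add, hx, hy, Finsupp.degree_single, map_add]
      omega
    have h₄ : homogeneousComponent 23 (X i * monomial (d + d) 1 : P5) =
        X i * monomial (d + d) 1 := by
      rw [X, monomial_mul_monomial, homogeneousComponent_of_mem (isHomogeneous_monomial 1 rfl),
        if_pos]
      rw [map_add, map_add, Finsupp.degree_single]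
      omega
    rw [hdr, add_mul, mul_add, mul_add, map_add, map_add, map_add, h₁, h₂, h₃, h₄, sq,
      monomial_mul_monomial, add_zero, add_zero, add_zero]
  rw [← hcomp, ← hsq, map_add, map_add, map_add]
  exact add_mem (add_mem (add_mem (by simpa using hmem 1 (by omega)) (hmem 2 (by omega)))
    (hmem 4 (by omega))) (hmem 8 (by omega))

lemma mul_mon_sq_mem_hitSpan (i : Fin 5) {a b c d e : ℕ} (h : a + b + c + d + e = 11) :
    X i * mon a b c d e ^ 2 ∈ hitSpan 23 := by
  rw [mon_eq_monomial]
  refine X_mul_monomial_sq_mem_hitSpan i ?_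
  rw [degree_eq_sum]
  simpa [exponents] using h

/-! ### Monomials with at least three odd exponents -/

/-- For `k < 10`, the `k`-th kind of monomials with three odd exponents; otherwise the monomials
with five odd exponents. -/
def oddMon : ℕ → ℕ → ℕ → ℕ → ℕ → ℕ → P5
  | 0, a, b, c, d, e => mon (a.bit true) (b.bit true) (c.bit true) (d.bit false) (e.bit false)
  | 1, a, b, c, d, e => mon (a.bit true) (b.bit true) (c.bit false) (d.bit true) (e.bit false)
  | 2, a, b, c, d, e => mon (a.bit true) (b.bit true) (c.bit false) (d.bit false) (e.bit true)
  | 3, a, b, c, d, e => mon (a.bit true) (b.bit false) (c.bit true) (d.bit true) (e.bit false)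
  | 4, a, b, c, d, e => mon (a.bit true) (b.bit false) (c.bit true) (d.bit false) (e.bit true)
  | 5, a, b, c, d, e => mon (a.bit true) (b.bit false) (c.bit false) (d.bit true) (e.bit true)
  | 6, a, b, c, d, e => mon (a.bit false) (b.bit true) (c.bit true) (d.bit true) (e.bit false)
  | 7, a, b, c, d, e => mon (a.bit false) (b.bit true) (c.bit true) (d.bit false) (e.bit true)
  | 8, a, b, c, d, e => mon (a.bit false) (b.bit true) (c.bit false) (d.bit true) (e.bit true)
  | 9, a, b, c, d, e => mon (a.bit false) (b.bit false) (c.bit true) (d.bit true) (e.bit true)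
  | _, a, b, c, d, e => mon (a.bit true) (b.bit true) (c.bit true) (d.bit true) (e.bit true)

/-- The monomials of degree `23` with at least three odd exponents. -/
def mons : List P5 :=
  ((upto 9).flatMap fun k => comps 10 (fun a b c d e => [oddMon k a b c d e]) []) ++
    comps 9 (fun a b c d e => [oddMon 10 a b c d e]) []

lemma codeMap_oddMon {k a b c d e : ℕ} (hk : k ≤ 9) (h : a + b + c + d + e = 10) :
    codeMap (oddMon k a b c d e) = bv (phi k (code a b c d)) := by
  interval_cases k <;> simp only [oddMon, codeMap_mon, monCode, codeDeg_of_eq h]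

lemma codeMap_oddMon_ten {a b c d e : ℕ} (h : a + b + c + d + e = 9) :
    codeMap (oddMon 10 a b c d e) = bv (phi 10 (code a b c d)) := by
  simp only [oddMon, codeMap_mon, monCode, codeDeg_of_eq h]

lemma codes_eq : codes =
    ((upto 9).flatMap fun k => comps 10 (fun a b c d _ => [phi k (code a b c d)]) []) ++
      comps 9 (fun a b c d _ => [phi 10 (code a b c d)]) [] :=
  rec_eq_flatMap (F := fun k r => comps 10 (fun a b c d _ => [phi k (code a b c d)]) r)
    (G := fun k => comps 10 (fun a b c d _ => [phi k (code a b c d)]) [])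
    (fun k r => by rw [comps_eq, comps_eq, List.append_nil])
    (comps 9 (fun a b c d _ => [phi 10 (code a b c d)]) []) (upto 9)

lemma map_mons : mons.map codeMap = codes.map bv := by
  rw [mons, codes_eq, List.map_append, List.map_append, List.map_flatMap, List.map_flatMap]
  congr 1
  · refine List.flatMap_congr fun k hk => map_comps_congr (fun a b c d e h => ?_) rfl
    rw [List.map_singleton, List.map_singleton, codeMap_oddMon (mem_upto.1 hk) h]
  · refine map_comps_congr (fun a b c d e h => ?_) rfl
    rw [List.map_singleton, List.map_singleton, codeMap_oddMon_ten h]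

lemma mem_mons {x : P5} : x ∈ mons ↔
    (∃ k ≤ 9, ∃ a b c d e, a + b + c + d + e = 10 ∧ x = oddMon k a b c d e) ∨
      ∃ a b c d e, a + b + c + d + e = 9 ∧ x = oddMon 10 a b c d e := by
  simp only [mons, List.mem_append, List.mem_flatMap, mem_upto, mem_comps, List.mem_singleton,
    List.not_mem_nil, or_false]

/-- The span of the monomials of degree `23` with at least three odd exponents. -/
def oddSpan : Submodule (ZMod 2) P5 := Submodule.span (ZMod 2) {x | x ∈ mons}

lemma map_codeMap_oddSpan : oddSpan.map codeMap = spanL codes := by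
  rw [oddSpan, Submodule.map_span, spanL]
  congr 1
  ext y
  have h : y ∈ mons.map codeMap ↔ y ∈ codes.map bv := by rw [map_mons]
  simpa only [List.mem_map, eq_comm, Set.mem_image, Set.mem_ofPred_eq] using h

lemma finrank_spanL_codes : Module.finrank (ZMod 2) (spanL codes) = 10725 :=
  (finrank_spanL isEchelon_codes).1

instance : FiniteDimensional (ZMod 2) oddSpan :=
  FiniteDimensional.span_of_finite _ (List.finite_toSet mons)

lemma finrank_oddSpan_le : Module.finrank (ZMod 2) oddSpan ≤ 10725 := by
  classical
  have hlen : mons.length = 10725 := by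
    rw [← List.length_map codeMap, map_mons, List.length_map]
    exact (finrank_spanL isEchelon_codes).2
  have h := finrank_span_finset_le_card (R := ZMod 2) mons.toFinset
  rw [List.coe_toFinset] at h
  exact h.trans ((List.toFinset_card_le mons).trans hlen.le)

lemma eq_zero_of_mem_oddSpan {x : P5} (hx : x ∈ oddSpan) (h : codeMap x = 0) : x = 0 := by
  have hr := (codeMap.domRestrict oddSpan).finrank_range_add_finrank_ker
  rw [LinearMap.range_domRestrict, map_codeMap_oddSpan, finrank_spanL_codes] at hr
  have hker : LinearMap.ker (codeMap.domRestrict oddSpan) = ⊥ := by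
    rw [← Submodule.finrank_eq_zero (R := ZMod 2)]
    have := finrank_oddSpan_le
    omega
  have hx0 : (⟨x, hx⟩ : oddSpan) ∈ LinearMap.ker (codeMap.domRestrict oddSpan) := h
  rw [hker, Submodule.mem_bot] at hx0
  exact congrArg Subtype.val hx0

lemma oddMon_mem_oddSpan {k a b c d e : ℕ} (hk : k ≤ 9) (h : a + b + c + d + e = 10) :
    oddMon k a b c d e ∈ oddSpan :=
  Submodule.subset_span (mem_mons.2 (.inl ⟨k, hk, a, b, c, d, e, h, rfl⟩))

lemma monomial_mem_sup {x : Fin 5 →₀ ℕ} (hx : x.degree = 23) :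
    (monomial x 1 : P5) ∈ oddSpan ⊔ hitSpan 23 ⊓ LinearMap.ker codeMap := by
  rw [degree_eq_sum] at hx
  obtain ⟨s₁, a, h₁⟩ := exists_bit_eq (x 0)
  obtain ⟨s₂, b, h₂⟩ := exists_bit_eq (x 1)
  obtain ⟨s₃, c, h₃⟩ := exists_bit_eq (x 2)
  obtain ⟨s₄, d, h₄⟩ := exists_bit_eq (x 3)
  obtain ⟨s₅, e, h₅⟩ := exists_bit_eq (x 4)
  rw [h₁, h₂, h₃, h₄, h₅] at hx
  rw [monomial_eq_mon, h₁, h₂, h₃, h₄, h₅]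
  clear h₁ h₂ h₃ h₄ h₅ x
  simp only [Nat.bit_val] at hx
  obtain hs | hs | hs : s₁.toNat + s₂.toNat + s₃.toNat + s₄.toNat + s₅.toNat = 1 ∨
      s₁.toNat + s₂.toNat + s₃.toNat + s₄.toNat + s₅.toNat = 3 ∨
      s₁.toNat + s₂.toNat + s₃.toNat + s₄.toNat + s₅.toNat = 5 := by
    have h₁ := s₁.toNat_le
    have h₂ := s₂.toNat_le
    have h₃ := s₃.toNat_le
    have h₄ := s₄.toNat_le
    have h₅ := s₅.toNat_le
    omega
  · refine Submodule.mem_sup_right ⟨?_, ?_⟩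
    · obtain ⟨i, hi⟩ : ∃ i : Fin 5, mon (Nat.bit s₁ a) (Nat.bit s₂ b) (Nat.bit s₃ c) (Nat.bit s₄ d)
          (Nat.bit s₅ e) = X i * mon a b c d e ^ 2 := by
        have key : mon (Nat.bit s₁ a) (Nat.bit s₂ b) (Nat.bit s₃ c) (Nat.bit s₄ d) (Nat.bit s₅ e) =
            (X 0 ^ s₁.toNat * X 1 ^ s₂.toNat * X 2 ^ s₃.toNat * X 3 ^ s₄.toNat * X 4 ^ s₅.toNat) *
              mon a b c d e ^ 2 := by
          simp only [mon, Nat.bit_val]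
          ring
        rw [key]
        cases s₁ <;> cases s₂ <;> cases s₃ <;> cases s₄ <;> cases s₅ <;>
          solve
          | contradiction
          | (refine ⟨0, ?_⟩; simp)
          | (refine ⟨1, ?_⟩; simp)
          | (refine ⟨2, ?_⟩; simp)
          | (refine ⟨3, ?_⟩; simp)
          | (refine ⟨4, ?_⟩; simp)
      rw [hi]
      exact mul_mon_sq_mem_hitSpan i (by omega)
    · rw [SetLike.mem_coe, LinearMap.mem_ker, codeMap_mon, ← bv_zero]
      congr 1
      cases s₁ <;> cases s₂ <;> cases s₃ <;> cases s₄ <;> cases s₅ <;>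
        first | contradiction | rfl
  · apply Submodule.mem_sup_left
    have hdeg : a + b + c + d + e = 10 := by omega
    obtain ⟨k, hk, heq⟩ : ∃ k ≤ 9, mon (Nat.bit s₁ a) (Nat.bit s₂ b) (Nat.bit s₃ c) (Nat.bit s₄ d)
        (Nat.bit s₅ e) = oddMon k a b c d e := by
      clear hx hdeg
      cases s₁ <;> cases s₂ <;> cases s₃ <;> cases s₄ <;> cases s₅ <;>
        solve
        | contradiction
        | (refine ⟨0, by decide, ?_⟩; simp only [oddMon])
        | (refine ⟨1, by decide, ?_⟩; simp only [oddMon])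
        | (refine ⟨2, by decide, ?_⟩; simp only [oddMon])
        | (refine ⟨3, by decide, ?_⟩; simp only [oddMon])
        | (refine ⟨4, by decide, ?_⟩; simp only [oddMon])
        | (refine ⟨5, by decide, ?_⟩; simp only [oddMon])
        | (refine ⟨6, by decide, ?_⟩; simp only [oddMon])
        | (refine ⟨7, by decide, ?_⟩; simp only [oddMon])
        | (refine ⟨8, by decide, ?_⟩; simp only [oddMon])
        | (refine ⟨9, by decide, ?_⟩; simp only [oddMon])
    rw [heq]
    exact oddMon_mem_oddSpan hk hdeg
  · refine Submodule.mem_sup_left (Submodule.subset_span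
      (mem_mons.2 (.inr ⟨a, b, c, d, e, by omega, ?_⟩)))
    cases s₁ <;> cases s₂ <;> cases s₃ <;> cases s₄ <;> cases s₅ <;>
      first | contradiction | simp only [oddMon]

lemma homogeneousSubmodule_le :
    homogeneousSubmodule (Fin 5) (ZMod 2) 23 ≤
      oddSpan ⊔ hitSpan 23 ⊓ LinearMap.ker codeMap := by
  intro f hf
  rw [f.as_sum]
  refine sum_mem fun d hd => ?_
  rw [← mul_one (coeff d f), ← smul_eq_mul, ← smul_monomial]
  refine Submodule.smul_mem _ _ (monomial_mem_sup ?_)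
  by_contra h
  exact mem_support_iff.1 hd (((mem_homogeneousSubmodule _ _).1 hf).coeff_eq_zero h)

lemma oddSpan_le : oddSpan ≤ homogeneousSubmodule (Fin 5) (ZMod 2) 23 := by
  rw [oddSpan, Submodule.span_le]
  have hmon : ∀ {a b c d e : ℕ}, a + b + c + d + e = 23 →
      mon a b c d e ∈ homogeneousSubmodule (Fin 5) (ZMod 2) 23 := by
    intro a b c d e h
    rw [mon_eq_monomial, mem_homogeneousSubmodule]
    apply isHomogeneous_monomial
    rw [degree_eq_sum]
    simpa [exponents] using h
  intro x hx
  rw [SetLike.mem_coe]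
  obtain ⟨k, hk, a, b, c, d, e, h, rfl⟩ | ⟨a, b, c, d, e, h, rfl⟩ := mem_mons.1 hx
  · interval_cases k <;>
      exact hmon (by simp only [Nat.bit_val, Bool.toNat_true, Bool.toNat_false]; omega)
  · exact hmon (by simp only [Nat.bit_val, Bool.toNat_true]; omega)

lemma hitSpan_le : hitSpan 23 ≤ homogeneousSubmodule (Fin 5) (ZMod 2) 23 := by
  rw [hitSpan, Submodule.span_le]
  rintro _ ⟨g, -, rfl⟩
  exact homogeneousComponent_mem 23 (Sq g)

lemma map_codeMap_homogeneousSubmodule :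
    (homogeneousSubmodule (Fin 5) (ZMod 2) 23).map codeMap = spanL codes := by
  rw [← map_codeMap_oddSpan]
  apply le_antisymm
  · refine (Submodule.map_mono homogeneousSubmodule_le).trans ?_
    rw [Submodule.map_sup]
    refine sup_le le_rfl ?_
    rintro _ ⟨x, ⟨-, hx⟩, rfl⟩
    rw [LinearMap.mem_ker.1 hx]
    exact zero_mem _
  · exact Submodule.map_mono oddSpan_le

lemma codeMap_mem_spanL_relations {x : P5} (hx : x ∈ homogeneousSubmodule (Fin 5) (ZMod 2) 23) :
    codeMap x ∈ spanL relations ↔ x ∈ hitSpan 23 := by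
  rw [spanL_relations]
  refine ⟨?_, Submodule.mem_map_of_mem⟩
  rintro ⟨y, hy, hxy⟩
  obtain ⟨u, hu, v, ⟨hv, hv'⟩, huv⟩ :=
    Submodule.mem_sup.1 (homogeneousSubmodule_le (sub_mem hx (hitSpan_le hy)))
  have hu0 : u = 0 := by
    apply eq_zero_of_mem_oddSpan hu
    rw [eq_sub_of_add_eq huv, map_sub, map_sub, hxy, sub_self, LinearMap.mem_ker.1 hv', sub_zero]
  rw [hu0, zero_add] at huv
  rw [← sub_add_cancel x y, ← huv]
  exact add_mem hv hy

lemma finrank_spanL_relations : Module.finrank (ZMod 2) (spanL relations) = 9480 := by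
  rw [← spanL_echelon 14 relations]
  exact (finrank_spanL isEchelon_relations).1

lemma finrank_quotient_comap_add_finrank {K V U : Type*} [Field K] [AddCommGroup V] [Module K V]
    [AddCommGroup U] [Module K U] {H N : Submodule K V} {f : V →ₗ[K] U} {R W : Submodule K U}
    [FiniteDimensional K W] (hN : ∀ x ∈ H, f x ∈ R ↔ x ∈ N) (hW : H.map f = W) (hR : R ≤ W) :
    Module.finrank K (H ⧸ N.comap H.subtype) + Module.finrank K R = Module.finrank K W := by
  have hker : N.comap H.subtype = LinearMap.ker (R.mkQ ∘ₗ f.domRestrict H) := by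
    ext x
    rw [LinearMap.ker_comp, Submodule.ker_mkQ]
    exact (hN x x.2).symm
  rw [hker, (LinearMap.quotKerEquivRange _).finrank_eq, LinearMap.range_comp,
    LinearMap.range_domRestrict, hW, ← (R.mkQ.domRestrict W).finrank_range_add_finrank_ker,
    LinearMap.range_domRestrict, LinearMap.ker_domRestrict, Submodule.ker_mkQ,
    (Submodule.comapSubtypeEquivOfLe hR).finrank_eq]

lemma spanL_relations_le : spanL relations ≤ spanL codes := by
  rw [spanL_relations, ← map_codeMap_homogeneousSubmodule]
  exact Submodule.map_mono hitSpan_le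

end QP5

/-- `dim_{F_2} (QP_5)_23 = 1245`. -/
theorem stmt1 :
    Module.finrank (ZMod 2)
      (↥(homogeneousSubmodule (Fin 5) (ZMod 2) 23) ⧸
        Submodule.comap (homogeneousSubmodule (Fin 5) (ZMod 2) 23).subtype (hitSpan 23)) = 1245 := by
  have h := QP5.finrank_quotient_comap_add_finrank
    (fun _ hx => QP5.codeMap_mem_spanL_relations hx)
    QP5.map_codeMap_homogeneousSubmodule QP5.spanL_relations_le
  rw [QP5.finrank_spanL_relations, QP5.finrank_spanL_codes] at h
  exact Nat.add_right_cancel (m := 9480) h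
end
end
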